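/- Let d > 0 and θ be real numbers. Then for every integer N ≥ 2, (1/(2πi)) · Σ_{1 ≤ |n| ≤ N} ζ(2πidn) · e^{2πiθn}/n = Σ_{0 < h < d log N, h ∈ ℤ} Σ_{1 ≤ n ≤ dN·e^{−(h+θ)/d}} sin(2πn·e^{(h+θ)/d})/(nπ) + O((log N)^{2/3}·(log log N)^{5/9}), where the implied constant may depend on d and θ. -/

import Mathlib

namespace ZS
open Real

noncomputable def sw (x : ℝ) : ℝ := Int.fract x - 1/2
noncomputable def DK (N : ℕ) (u : ℝ) : ℝ := 1 + 2 * ∑ n ∈ Finset.Icc 1 N, Real.cos (2 * π * n * u)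
noncomputable def SS (N : ℕ) (y : ℝ) : ℝ := ∑ n ∈ Finset.Icc 1 N, Real.sin (2 * π * n * y) / (n * π)

lemma sin_mul_DK (N : ℕ) (u : ℝ) : Real.sin (π * u) * DK N u = Real.sin ((2 * N + 1) * π * u) := by
  induction N with
  | zero => simp [DK]
  | succ k ih =>
    have h : DK (k+1) u = DK k u + 2 * Real.cos (2 * π * ((k + 1 : ℕ) : ℝ) * u) := by
      unfold DK
      rw [Finset.sum_Icc_succ_top (by omega)]
      ring
    rw [h, mul_add, ih]
    have e1 : (2 * (k:ℝ) + 1) * π * u = 2 * π * ((k + 1 : ℕ) : ℝ) * u - π * u := by push_cast; ring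
    have e2 : (2 * ((k+1 : ℕ):ℝ) + 1) * π * u = 2 * π * ((k + 1 : ℕ) : ℝ) * u + π * u := by
      push_cast; ring
    rw [e1, e2, Real.sin_sub, Real.sin_add]
    ring

lemma DK_abs_le (N : ℕ) (u : ℝ) : |DK N u| ≤ 2 * N + 1 := by
  unfold DK
  have : |∑ n ∈ Finset.Icc 1 N, Real.cos (2 * π * n * u)| ≤ N := by
    refine (Finset.abs_sum_le_sum_abs _ _).trans ?_
    refine (Finset.sum_le_sum (fun n _ => Real.abs_cos_le_one _)).trans ?_
    simp
  rw [abs_le] at *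
  constructor <;> linarith [this.1, this.2]

lemma DK_even (N : ℕ) (u : ℝ) : DK N (-u) = DK N u := by
  unfold DK
  congr 2
  apply Finset.sum_congr rfl
  intro n _
  rw [mul_neg, Real.cos_neg]

lemma DK_add_int (N : ℕ) (u : ℝ) (k : ℤ) : DK N (u + k) = DK N u := by
  unfold DK
  congr 2
  apply Finset.sum_congr rfl
  intro n _
  rw [show 2 * π * n * (u + k) = 2 * π * n * u + ((n * k : ℤ) : ℝ) * (2 * π) by push_cast; ring,
    Real.cos_add_int_mul_two_pi]

lemma SS_add_int (N : ℕ) (u : ℝ) (k : ℤ) : SS N (u + k) = SS N u := by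
  unfold SS
  apply Finset.sum_congr rfl
  intro n _
  rw [show 2 * π * n * (u + k) = 2 * π * n * u + ((n * k : ℤ) : ℝ) * (2 * π) by push_cast; ring,
    Real.sin_add_int_mul_two_pi]

lemma SS_odd (N : ℕ) (u : ℝ) : SS N (-u) = - SS N u := by
  unfold SS
  rw [← Finset.sum_neg_distrib]
  apply Finset.sum_congr rfl
  intro n _
  rw [mul_neg, Real.sin_neg, neg_div]

@[fun_prop]
lemma DK_cont (N : ℕ) : Continuous (DK N) := by
  unfold DK; fun_prop

@[fun_prop]
lemma SS_cont (N : ℕ) : Continuous (SS N) := by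
  unfold SS; fun_prop

lemma SS_hasDeriv (N : ℕ) (y : ℝ) : HasDerivAt (SS N) (DK N y - 1) y := by
  have : DK N y - 1 = ∑ n ∈ Finset.Icc 1 N, 2 * Real.cos (2 * π * n * y) := by
    unfold DK; rw [Finset.mul_sum]; ring
  rw [this]
  unfold SS
  apply HasDerivAt.fun_sum
  intro n hn
  have hn0 : (n:ℝ) ≠ 0 := by
    have := (Finset.mem_Icc.1 hn).1
    positivity
  have h1 : HasDerivAt (fun y : ℝ => 2 * π * n * y) (2 * π * n) y := by
    simpa using (hasDerivAt_id y).const_mul (2 * π * n)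
  have h2 := (h1.sin).div_const (n * π)
  refine h2.congr_deriv ?_
  field_simp

lemma sin_pi_ge {y : ℝ} (h0 : 0 ≤ y) (h1 : y ≤ 1/2) : 2 * y ≤ Real.sin (π * y) := by
  have := Real.mul_le_sin (x := π * y) (by positivity) (by nlinarith [Real.pi_pos])
  calc 2 * y = 2 / π * (π * y) := by field_simp
    _ ≤ _ := this

lemma DK_abs_le' (N : ℕ) {u : ℝ} (h0 : 0 < u) (h1 : u ≤ 1/2) : |DK N u| ≤ 1 / (2 * u) := by
  have hs := sin_pi_ge h0.le h1
  have hs0 : 0 < Real.sin (π * u) := by linarith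
  have := sin_mul_DK N u
  have h2 : Real.sin (π * u) * |DK N u| ≤ 1 := by
    rw [← abs_of_pos hs0, ← abs_mul, this]; exact Real.abs_sin_le_one _
  rw [le_div_iff₀ (by positivity)]
  nlinarith [abs_nonneg (DK N u)]

lemma SS_bound (N : ℕ) {y : ℝ} (h0 : 0 < y) (h1 : y ≤ 1/2) :
    |SS N y + y - 1/2| ≤ 1 / ((2 * N + 1) * y) := by
  set P : ℝ := 2 * N + 1 with hP
  have hP0 : 0 < P := by positivity
  -- G(u) = 1/(Pπ sin πu),  F(u) = SS+u-1/2 + cos(Pπu)/(Pπ sin πu)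
  have key : ∀ u, 0 < u → u ≤ 1/2 → HasDerivAt
      (fun u => SS N u + u - 1/2 + Real.cos (P * π * u) / (P * π * Real.sin (π * u)))
      (- Real.cos (P * π * u) * Real.cos (π * u) / (P * Real.sin (π * u)^2)) u ∧
      HasDerivAt (fun u => 1 / (P * π * Real.sin (π * u)))
        (- Real.cos (π * u) / (P * Real.sin (π * u)^2)) u := by
    intro u hu hu1
    have hs0 : 0 < Real.sin (π * u) := by linarith [sin_pi_ge hu.le hu1]
    have a1 : HasDerivAt (fun y : ℝ => Real.sin (π * y)) (Real.cos (π * u) * π) u := by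
      simpa using ((hasDerivAt_id u).const_mul π).sin
    have a2 : HasDerivAt (fun y : ℝ => Real.cos (P * π * y)) (- Real.sin (P * π * u) * (P * π)) u := by
      simpa using ((hasDerivAt_id u).const_mul (P * π)).cos
    have a3 := a1.const_mul (P * π)
    have hne : P * π * Real.sin (π * u) ≠ 0 := by positivity
    constructor
    · have := ((((SS_hasDeriv N u).add (hasDerivAt_id u)).sub_const (1/2))).add (a2.div a3 hne)
      refine this.congr_deriv ?_
      have hd : DK N u = Real.sin (P * π * u) / Real.sin (π * u) := by
        rw [eq_div_iff hs0.ne', mul_comm, sin_mul_DK]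
      rw [hd]
      field_simp
      ring
    · have := (hasDerivAt_const u (1:ℝ)).div a3 hne
      refine this.congr_deriv ?_
      field_simp
      ring
  have half : Real.cos (P * π * (1/2)) = 0 := by
    rw [Real.cos_eq_zero_iff]
    exact ⟨N, by rw [hP]; push_cast; ring⟩
  have sshalf : SS N (1/2) = 0 := by
    unfold SS
    apply Finset.sum_eq_zero
    intro n _
    rw [show 2 * π * n * (1/2) = n * π by ring, Real.sin_nat_mul_pi, zero_div]
  set F := fun u => SS N u + u - 1/2 + Real.cos (P * π * u) / (P * π * Real.sin (π * u)) with hF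
  set G := fun u => 1 / (P * π * Real.sin (π * u)) with hG
  have hcont : ∀ u ∈ Set.Icc y (1/2), ContinuousAt F u ∧ ContinuousAt G u := by
    intro u hu
    have := key u (by linarith [hu.1]) hu.2
    exact ⟨this.1.continuousAt, this.2.continuousAt⟩
  have hpos : ∀ u ∈ interior (Set.Icc y (1/2)), 0 < u ∧ u ≤ 1/2 := by
    intro u hu
    have := interior_subset hu
    exact ⟨by linarith [this.1], this.2⟩
  have hcos : ∀ u, 0 < u → u ≤ 1/2 → 0 ≤ Real.cos (π * u) := by
    intro u hu hu1
    apply Real.cos_nonneg_of_neg_pi_div_two_le_of_le <;> nlinarith [Real.pi_pos]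
  have m1 : AntitoneOn (fun u => G u + F u) (Set.Icc y (1/2)) := by
    apply antitoneOn_of_hasDerivWithinAt_nonpos (convex_Icc _ _)
      (fun u hu => ((hcont u hu).2.add (hcont u hu).1).continuousWithinAt)
      (fun u hu => ((key u (hpos u hu).1 (hpos u hu).2).2.add
        (key u (hpos u hu).1 (hpos u hu).2).1).hasDerivWithinAt)
    intro u hu
    have h1 := hcos u (hpos u hu).1 (hpos u hu).2
    have h2 := Real.neg_one_le_cos (P * π * u)
    rw [← add_div]
    apply div_nonpos_of_nonpos_of_nonneg
    · nlinarith
    · positivity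
  have m2 : AntitoneOn (fun u => G u - F u) (Set.Icc y (1/2)) := by
    apply antitoneOn_of_hasDerivWithinAt_nonpos (convex_Icc _ _)
      (fun u hu => ((hcont u hu).2.sub (hcont u hu).1).continuousWithinAt)
      (fun u hu => ((key u (hpos u hu).1 (hpos u hu).2).2.sub
        (key u (hpos u hu).1 (hpos u hu).2).1).hasDerivWithinAt)
    intro u hu
    have h1 := hcos u (hpos u hu).1 (hpos u hu).2
    have h2 := Real.cos_le_one (P * π * u)
    rw [← sub_div]
    apply div_nonpos_of_nonpos_of_nonneg
    · nlinarith
    · positivity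
  have hy : y ∈ Set.Icc y (1/2) := ⟨le_rfl, h1⟩
  have hh : (1/2:ℝ) ∈ Set.Icc y (1/2) := ⟨h1, le_rfl⟩
  have r1 := m1 hy hh h1
  have r2 := m2 hy hh h1
  have Fh : F (1/2) = 0 := by
    simp only [hF, half, sshalf]; norm_num
  have Gh : 0 ≤ G (1/2) := by
    simp only [hG]
    rw [show π * (1/2) = π / 2 by ring, Real.sin_pi_div_two]
    positivity
  have hs := sin_pi_ge h0.le h1
  have hs0 : 0 < Real.sin (π * y) := by linarith
  have Gy : G y ≤ 1 / (P * π * (2 * y)) := by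
    simp only [hG]
    gcongr
  simp only [Fh] at r1 r2
  have hc : |Real.cos (P * π * y) / (P * π * Real.sin (π * y))| ≤ G y := by
    rw [abs_div, abs_of_pos (show 0 < P * π * Real.sin (π * y) by positivity)]
    simp only [hG]
    gcongr
    exact Real.abs_cos_le_one _
  have hfin : 1 / (P * π * (2 * y)) * 2 ≤ 1 / (P * y) := by
    rw [show 1 / (P * π * (2 * y)) * 2 = 1 / (P * y) * (1 / π) by field_simp]
    apply mul_le_of_le_one_right (by positivity)
    rw [div_le_one Real.pi_pos]; linarith [Real.pi_gt_three]
  rw [abs_le] at hc ⊢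
  have : F y = SS N y + y - 1/2 + Real.cos (P * π * y) / (P * π * Real.sin (π * y)) := rfl
  constructor <;> linarith [hc.1, hc.2]

lemma SS_le_half (N : ℕ) {y : ℝ} (h0 : 0 ≤ y) (h1 : y ≤ 1/2) : |SS N y| ≤ 2 := by
  by_cases h : 1 ≤ (2 * N + 1) * y
  · have hy : 0 < y := by
      by_contra hy
      have : y = 0 := by linarith
      simp [this] at h; linarith
    have := SS_bound N hy h1
    have h2 : 1 / ((2 * N + 1) * y) ≤ 1 := by
      rw [div_le_one (by linarith)]; exact h
    rw [abs_le] at *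
    constructor <;> linarith [this.1, this.2]
  · push Not at h
    unfold SS
    calc _ ≤ ∑ n ∈ Finset.Icc 1 N, |Real.sin (2 * π * n * y) / (n * π)| :=
          Finset.abs_sum_le_sum_abs _ _
      _ ≤ ∑ n ∈ Finset.Icc 1 N, 2 * y := by
          apply Finset.sum_le_sum
          intro n hn
          have hn0 : 0 < (n:ℝ) := by
            have := (Finset.mem_Icc.1 hn).1
            positivity
          rw [abs_div, abs_of_pos (show 0 < n * π by positivity), div_le_iff₀ (by positivity)]
          calc _ ≤ |2 * π * n * y| := Real.abs_sin_le_abs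
            _ = 2 * π * n * y := abs_of_nonneg (by positivity)
            _ = _ := by ring
      _ = N * (2 * y) := by simp
      _ ≤ 2 := by nlinarith

lemma SS_le (N : ℕ) (y : ℝ) : |SS N y| ≤ 2 := by
  have e : SS N y = SS N (y - round y) := by
    have := SS_add_int N (y - round y) (round y)
    rw [← this]; congr 1; ring
  rw [e]
  have h := abs_sub_round y
  rcases le_total 0 (y - round y) with h0 | h0
  · exact SS_le_half N h0 (by linarith [abs_of_nonneg h0])
  · have := SS_le_half N (y := -(y - round y)) (by linarith) (by linarith [abs_of_nonpos h0])
    rwa [SS_odd, abs_neg] at this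

lemma int_DK (N : ℕ) (δ : ℝ) : ∫ u in (0:ℝ)..δ, DK N u = SS N δ + δ := by
  have h : ∀ x ∈ Set.uIcc 0 δ, HasDerivAt (fun u => SS N u + u) (DK N x) x := by
    intro x _
    have := (SS_hasDeriv N x).add (hasDerivAt_id x)
    refine this.congr_deriv ?_
    ring
  rw [intervalIntegral.integral_eq_sub_of_hasDerivAt h ((DK_cont N).intervalIntegrable _ _)]
  simp [SS]

lemma SS_tendsto {y : ℝ} (hy : Int.fract y ≠ 0) :
    Filter.Tendsto (fun R => SS R y) Filter.atTop (nhds (- sw y)) := by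
  set z := Int.fract y with hz
  have hz0 : 0 < z := lt_of_le_of_ne (Int.fract_nonneg y) (Ne.symm hy)
  have hz1 : z < 1 := Int.fract_lt_one y
  have e : ∀ R, SS R y = SS R z := by
    intro R
    rw [← SS_add_int R z ⌊y⌋, hz, Int.fract_add_floor]
  simp_rw [e]
  obtain ⟨w, hw0, hb⟩ : ∃ w : ℝ, 0 < w ∧ ∀ R : ℕ, |SS R z - (- sw y)| ≤ 1 / ((2 * R + 1) * w) := by
    rcases le_total z (1/2) with h | h
    · refine ⟨z, hz0, fun R => ?_⟩
      have := SS_bound R hz0 h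
      unfold sw
      rw [← hz]
      convert this using 2; ring
    · refine ⟨1 - z, by linarith, fun R => ?_⟩
      have := SS_bound R (y := 1 - z) (by linarith) (by linarith)
      have e2 : SS R (1 - z) = - SS R z := by
        rw [← SS_odd, show (1 - z) = -z + (1:ℤ) by push_cast; ring, SS_add_int]
      unfold sw
      rw [← hz, abs_sub_comm]
      rw [e2] at this
      convert this using 2; ring
  rw [tendsto_iff_norm_sub_tendsto_zero]
  have lim : Filter.Tendsto (fun R : ℕ => 1 / ((2 * (R:ℝ) + 1) * w)) Filter.atTop (nhds 0) := by
    simp_rw [one_div]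
    apply Filter.Tendsto.inv_tendsto_atTop
    apply Filter.Tendsto.atTop_mul_const hw0
    apply Filter.tendsto_atTop_add_const_right
    exact Filter.Tendsto.const_mul_atTop (by norm_num) tendsto_natCast_atTop_atTop
  exact squeeze_zero (fun _ => norm_nonneg _) (fun R => by simpa using hb R) lim

end ZS

namespace ZS
open Real

noncomputable def ww (u : ℝ) : ℝ := 1 / Real.sin (π * u)

lemma abs_sub_le_of_deriv {f g f' g' : ℝ → ℝ} {p q : ℝ} (hpq : p ≤ q)
    (hf : ∀ u ∈ Set.Icc p q, HasDerivAt f (f' u) u) (hg : ∀ u ∈ Set.Icc p q, HasDerivAt g (g' u) u)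
    (h : ∀ u ∈ Set.Icc p q, |f' u| ≤ g' u) : |f q - f p| ≤ g q - g p := by
  have m1 : MonotoneOn (fun u => g u + f u) (Set.Icc p q) := by
    apply monotoneOn_of_hasDerivWithinAt_nonneg (convex_Icc _ _)
      (fun u hu => ((hg u hu).add (hf u hu)).continuousAt.continuousWithinAt)
      (fun u hu => ((hg u (interior_subset hu)).add (hf u (interior_subset hu))).hasDerivWithinAt)
    intro u hu
    have := h u (interior_subset hu)
    rw [abs_le] at this; linarith [this.1]
  have m2 : MonotoneOn (fun u => g u - f u) (Set.Icc p q) := by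
    apply monotoneOn_of_hasDerivWithinAt_nonneg (convex_Icc _ _)
      (fun u hu => ((hg u hu).sub (hf u hu)).continuousAt.continuousWithinAt)
      (fun u hu => ((hg u (interior_subset hu)).sub (hf u (interior_subset hu))).hasDerivWithinAt)
    intro u hu
    have := h u (interior_subset hu)
    rw [abs_le] at this; linarith [this.2]
  have r1 := m1 ⟨le_rfl, hpq⟩ ⟨hpq, le_rfl⟩ hpq
  have r2 := m2 ⟨le_rfl, hpq⟩ ⟨hpq, le_rfl⟩ hpq
  simp only at r1 r2
  rw [abs_le]; constructor <;> linarith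

lemma ww_pos {u : ℝ} (h0 : 0 < u) (h1 : u ≤ 1/2) : 0 < ww u := by
  have := sin_pi_ge h0.le h1
  unfold ww
  apply div_pos one_pos; linarith

lemma ww_le {u : ℝ} (h0 : 0 < u) (h1 : u ≤ 1/2) : ww u ≤ 1 / (2 * u) := by
  have := sin_pi_ge h0.le h1
  unfold ww
  gcongr

lemma ww_deriv {u : ℝ} (h0 : 0 < u) (h1 : u ≤ 1/2) :
    ∃ w' : ℝ, w' ≤ 0 ∧ HasDerivAt ww w' u := by
  have hs0 : 0 < Real.sin (π * u) := by linarith [sin_pi_ge h0.le h1]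
  have a1 : HasDerivAt (fun y : ℝ => Real.sin (π * y)) (Real.cos (π * u) * π) u := by
    simpa using ((hasDerivAt_id u).const_mul π).sin
  have := (hasDerivAt_const u (1:ℝ)).div a1 hs0.ne'
  refine ⟨_, ?_, this⟩
  have : 0 ≤ Real.cos (π * u) := by
    apply Real.cos_nonneg_of_neg_pi_div_two_le_of_le <;> nlinarith [Real.pi_pos]
  apply div_nonpos_of_nonpos_of_nonneg
  · have := Real.pi_pos
    have : 0 ≤ Real.cos (π * u) * π := by positivity
    linarith
  · positivity

lemma ww_anti {u v : ℝ} (h0 : 0 < u) (huv : u ≤ v) (h1 : v ≤ 1/2) : ww v ≤ ww u := by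
  have hs0 : 0 < Real.sin (π * u) := by linarith [sin_pi_ge h0.le (huv.trans h1)]
  unfold ww
  apply one_div_le_one_div_of_le hs0
  apply Real.sin_le_sin_of_le_of_le_pi_div_two <;> nlinarith [Real.pi_pos]

lemma ww_contOn {p q : ℝ} (hp : 0 < p) (hq : q ≤ 1/2) : ContinuousOn ww (Set.Icc p q) := by
  intro u hu
  obtain ⟨w', _, h⟩ := ww_deriv (u := u) (by linarith [hu.1]) (by linarith [hu.2])
  exact h.continuousAt.continuousWithinAt

lemma ww_cos_int {p q : ℝ} (hp : 0 < p) (hpq : p ≤ q) (hq : q ≤ 1/2) {f : ℝ → ℝ} (hf : Continuous f)  :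
    IntervalIntegrable (fun u => ww u * Real.cos (f u)) MeasureTheory.volume p q := by
  apply ContinuousOn.intervalIntegrable
  rw [Set.uIcc_of_le hpq]
  exact (ww_contOn hp hq).mul (Real.continuous_cos.comp hf).continuousOn

/-- first derivative test -/
lemma FD {φ φ' φ'' : ℝ → ℝ} {p q l s : ℝ} (hp : 0 < p) (hpq : p ≤ q) (hq : q ≤ 1/2) (hl : 0 < l)
    (hφ : ∀ u, HasDerivAt φ (φ' u) u) (hφ' : ∀ u, HasDerivAt φ' (φ'' u) u)
    (hs : |s| = 1) (hs' : ∀ u ∈ Set.Icc p q, |φ'' u| ≤ s * φ'' u)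
    (hlb : ∀ u ∈ Set.Icc p q, l ≤ φ' u) :
    |∫ u in p..q, ww u * Real.cos (φ u)| ≤ 5 * ww p / l := by
  have hpos : ∀ u ∈ Set.Icc p q, 0 < u ∧ u ≤ 1/2 := fun u hu => ⟨by linarith [hu.1], by linarith [hu.2]⟩
  have hw : ∀ u ∈ Set.Icc p q, HasDerivAt ww (deriv ww u) u ∧ deriv ww u ≤ 0 := by
    intro u hu
    obtain ⟨w', h1, h2⟩ := ww_deriv (hpos u hu).1 (hpos u hu).2
    rw [h2.deriv]; exact ⟨h2, h1⟩
  have hcφ : Continuous φ := continuous_iff_continuousAt.2 fun u => (hφ u).continuousAt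
  -- antiderivative
  set I : ℝ → ℝ := fun v => ∫ u in p..v, (ww (max p (min u q))) * Real.cos (φ u) with hI
  have hclamp : Continuous (fun u => ww (max p (min u q))) := by
    rw [← continuousOn_univ]
    apply (ww_contOn hp hq).comp (by fun_prop)
    intro u _
    exact ⟨le_max_left _ _, max_le hpq (min_le_right _ _)⟩
  have hcl : ∀ u ∈ Set.Icc p q, max p (min u q) = u := by
    intro u hu
    rw [min_eq_left hu.2, max_eq_right hu.1]
  have hId : ∀ u ∈ Set.Icc p q, HasDerivAt I (ww u * Real.cos (φ u)) u := by
    intro u hu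
    have hc : Continuous (fun u => (ww (max p (min u q))) * Real.cos (φ u)) :=
      hclamp.mul (Real.continuous_cos.comp hcφ)
    have := intervalIntegral.integral_hasDerivAt_right (hc.intervalIntegrable p u)
      hc.aestronglyMeasurable.stronglyMeasurableAtFilter hc.continuousAt
    rw [hcl u hu] at this
    exact this
  have hIq : I q = ∫ u in p..q, ww u * Real.cos (φ u) := by
    apply intervalIntegral.integral_congr
    intro u hu
    rw [Set.uIcc_of_le hpq] at hu
    simp only [hcl u hu]
  have hIp : I p = 0 := by simp [hI]
  have hφpos : ∀ u ∈ Set.Icc p q, 0 < φ' u := fun u hu => by linarith [hlb u hu]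
  have main := abs_sub_le_of_deriv (p := p) (q := q)
    (f := fun u => I u - ww u * Real.sin (φ u) / φ' u)
    (g := fun u => - ww u / l - ww p * s / φ' u)
    (f' := fun u => - Real.sin (φ u) * (deriv ww u / φ' u - ww u * φ'' u / φ' u ^ 2))
    (g' := fun u => - deriv ww u / l + ww p * s * φ'' u / φ' u ^ 2) hpq ?_ ?_ ?_
  · simp only [hIp, hIq] at main
    have hwp := ww_pos hp (hpq.trans hq)
    have hwq := ww_pos (hp.trans_le hpq) hq
    have hb : ∀ u ∈ Set.Icc p q, |ww u * Real.sin (φ u) / φ' u| ≤ ww p / l := by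
      intro u hu
      rw [abs_div, abs_mul, abs_of_pos (hφpos u hu), abs_of_pos (ww_pos (hpos u hu).1 (hpos u hu).2)]
      have h1 := ww_anti hp hu.1 (hpos u hu).2
      have h2 := Real.abs_sin_le_one (φ u)
      have h3 := hlb u hu
      calc _ ≤ ww p * 1 / l := by gcongr
        _ = _ := by ring
    have hb2 : ∀ u ∈ Set.Icc p q, |ww p * s / φ' u| ≤ ww p / l := by
      intro u hu
      rw [abs_div, abs_mul, hs, abs_of_pos (hφpos u hu), abs_of_pos hwp, mul_one]
      have h3 := hlb u hu
      gcongr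
    have b1 := hb p ⟨le_rfl, hpq⟩
    have b2 := hb q ⟨hpq, le_rfl⟩
    have b3 := hb2 p ⟨le_rfl, hpq⟩
    have b4 := hb2 q ⟨hpq, le_rfl⟩
    have b5 : 0 < ww q / l := by positivity
    have e1 : - ww q / l = -(ww q / l) := by ring
    have e2 : - ww p / l = -(ww p / l) := by ring
    have e3 : 5 * ww p / l = 5 * (ww p / l) := by ring
    rw [e1, e2] at main
    rw [e3]
    rw [abs_le] at *
    constructor <;> linarith [main.1, main.2, b1.1, b1.2, b2.1, b2.2, b3.1, b3.2, b4.1, b4.2]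
  · intro u hu
    have hne := (hφpos u hu).ne'
    have := (hId u hu).sub ((((hw u hu).1.mul (hφ u).sin)).div (hφ' u) hne)
    refine this.congr_deriv ?_
    simp only [Pi.mul_apply]
    field_simp
    ring
  · intro u hu
    have hne := (hφpos u hu).ne'
    have := ((hw u hu).1.neg.div_const l).sub ((hasDerivAt_const u (ww p * s)).div (hφ' u) hne)
    refine this.congr_deriv ?_
    field_simp
    ring
  · intro u hu
    have h0 := hφpos u hu
    have h1 := ww_anti hp hu.1 (hpos u hu).2
    have h2 := ww_pos (hpos u hu).1 (hpos u hu).2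
    have h3 := hlb u hu
    have h4 := hs' u hu
    have h5 := (hw u hu).2
    rw [abs_mul, abs_neg]
    calc _ ≤ 1 * |deriv ww u / φ' u - ww u * φ'' u / φ' u ^ 2| := by
          gcongr; exact Real.abs_sin_le_one _
      _ ≤ |deriv ww u / φ' u| + |ww u * φ'' u / φ' u ^ 2| := by
          rw [one_mul]; exact abs_sub _ _
      _ = (-deriv ww u) / φ' u + ww u * |φ'' u| / φ' u ^ 2 := by
          rw [abs_div, abs_div, abs_mul, abs_of_pos h0, abs_of_nonpos h5, abs_of_pos h2,
            abs_of_pos (show 0 < φ' u ^ 2 by positivity)]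
      _ ≤ (-deriv ww u) / l + ww p * (s * φ'' u) / φ' u ^ 2 := by
          gcongr
          all_goals linarith
      _ = _ := by ring

/-- the phase -/
noncomputable def ph (α κ β u : ℝ) : ℝ := α * Real.exp (κ * u) + β * u
noncomputable def ph' (α κ β u : ℝ) : ℝ := α * κ * Real.exp (κ * u) + β
noncomputable def ph'' (α κ u : ℝ) : ℝ := α * κ ^ 2 * Real.exp (κ * u)

lemma ph_d (α κ β u : ℝ) : HasDerivAt (ph α κ β) (ph' α κ β u) u := by
  have h1 : HasDerivAt (fun u : ℝ => Real.exp (κ * u)) (Real.exp (κ * u) * κ) u := by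
    simpa using ((hasDerivAt_id u).const_mul κ).exp
  have h2 := (h1.const_mul α).add ((hasDerivAt_id u).const_mul β)
  refine h2.congr_deriv ?_
  unfold ph'; ring

lemma ph'_d (α κ β u : ℝ) : HasDerivAt (ph' α κ β) (ph'' α κ u) u := by
  have h1 : HasDerivAt (fun u : ℝ => Real.exp (κ * u)) (Real.exp (κ * u) * κ) u := by
    simpa using ((hasDerivAt_id u).const_mul κ).exp
  have h2 := (h1.const_mul (α * κ)).add_const β
  refine h2.congr_deriv ?_
  unfold ph''; ring

lemma ph_cont (α κ β : ℝ) : Continuous (ph α κ β) := by unfold ph; fun_prop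
lemma ph'_cont (α κ β : ℝ) : Continuous (ph' α κ β) := by unfold ph'; fun_prop

lemma FDp {α κ β p q l : ℝ} (hα : 0 < α) (hp : 0 < p) (hpq : p ≤ q) (hq : q ≤ 1/2) (hl : 0 < l)
    (h : (∀ u ∈ Set.Icc p q, l ≤ ph' α κ β u) ∨ (∀ u ∈ Set.Icc p q, ph' α κ β u ≤ -l)) :
    |∫ u in p..q, ww u * Real.cos (ph α κ β u)| ≤ 5 * ww p / l := by
  have hn : ∀ u, 0 ≤ ph'' α κ u := fun u => by unfold ph''; positivity
  rcases h with h | h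
  · exact FD (s := 1) hp hpq hq hl (ph_d α κ β) (ph'_d α κ β) (by simp)
      (fun u _ => by rw [abs_of_nonneg (hn u), one_mul]) h
  · have := FD (s := -1) hp hpq hq hl (φ := fun u => - ph α κ β u) (φ' := fun u => - ph' α κ β u)
      (φ'' := fun u => - ph'' α κ u)
      (fun u => (ph_d α κ β u).neg) (fun u => (ph'_d α κ β u).neg) (by simp)
      (fun u _ => by rw [abs_neg, abs_of_nonneg (hn u)]; linarith) (fun u hu => by linarith [h u hu])
    simpa using this

lemma ph''_ge {α κ u : ℝ} (hα : 0 < α) (h0 : 0 ≤ u) (h1 : u ≤ 1/2) :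
    α * (κ ^ 2 * Real.exp (-(|κ|))) ≤ ph'' α κ u := by
  unfold ph''
  have : -|κ| ≤ κ * u := by
    have := neg_abs_le κ
    have := abs_nonneg κ
    nlinarith
  have := Real.exp_le_exp.2 this
  calc _ = α * κ^2 * Real.exp (-|κ|) := by ring
    _ ≤ _ := by gcongr

lemma ph''_le {α κ u : ℝ} (hα : 0 < α) (h0 : 0 ≤ u) (h1 : u ≤ 1/2) :
    ph'' α κ u ≤ α * (κ ^ 2 * Real.exp (|κ|)) := by
  unfold ph''
  have : κ * u ≤ |κ| := by
    have := le_abs_self κ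
    have := abs_nonneg κ
    nlinarith
  have := Real.exp_le_exp.2 this
  calc _ ≤ α * κ^2 * Real.exp (|κ|) := by gcongr
    _ = _ := by ring

lemma ph'_growth {α κ β u v : ℝ} (hα : 0 < α) (h0 : 0 ≤ u) (huv : u ≤ v) (h1 : v ≤ 1/2) :
    α * (κ ^ 2 * Real.exp (-(|κ|))) * (v - u) ≤ ph' α κ β v - ph' α κ β u ∧
    ph' α κ β v - ph' α κ β u ≤ α * (κ ^ 2 * Real.exp (|κ|)) * (v - u) := by
  rcases huv.eq_or_lt with rfl | hlt
  · simp
  obtain ⟨c, hc, he⟩ := exists_hasDerivAt_eq_slope (ph' α κ β) (ph'' α κ) hlt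
    (ph'_cont α κ β).continuousOn (fun x _ => ph'_d α κ β x)
  have e : ph' α κ β v - ph' α κ β u = ph'' α κ c * (v - u) := by
    rw [he, div_mul_cancel₀]; linarith
  have a1 := ph''_ge (α := α) (κ := κ) (u := c) hα (by linarith [hc.1]) (by linarith [hc.2])
  have a2 := ph''_le (α := α) (κ := κ) (u := c) hα (by linarith [hc.1]) (by linarith [hc.2])
  rw [e]
  have : 0 ≤ v - u := by linarith
  constructor <;> gcongr

/-- second derivative test -/
lemma SD {α κ β p : ℝ} (hα : 0 < α) (hκ : κ ≠ 0) (hp : 0 < p) (hq : p ≤ 1/2) :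
    |∫ u in p..(1/2), ww u * Real.cos (ph α κ β u)| ≤
      12 * ww p / √(α * (κ ^ 2 * Real.exp (-(|κ|)))) := by
  set μ := α * (κ ^ 2 * Real.exp (-(|κ|))) with hμ
  have hμ0 : 0 < μ := by positivity
  set l := √μ with hl
  have hl0 : 0 < l := Real.sqrt_pos.2 hμ0
  have hll : l * l = μ := Real.mul_self_sqrt hμ0.le
  set η := 1 / l with hη
  have hη0 : 0 < η := by positivity
  have hμη : μ * η = l := by rw [← hll, hη]; field_simp
  have hmono : ∀ u v, 0 ≤ u → u ≤ v → v ≤ 1/2 → μ * (v - u) ≤ ph' α κ β v - ph' α κ β u :=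
    fun u v h0 h1 h2 => (ph'_growth hα h0 h1 h2).1
  obtain ⟨c, hc1, hc2, hl1, hr1⟩ : ∃ c, p ≤ c ∧ c ≤ 1/2 ∧ (∀ u ∈ Set.Ico p c, ph' α κ β c ≤ 0) ∧
      (∀ u ∈ Set.Ioc c (1/2), 0 ≤ ph' α κ β c) := by
    by_cases h1 : 0 ≤ ph' α κ β p
    · exact ⟨p, le_rfl, hq, fun u hu => by simp at hu, fun u _ => h1⟩
    by_cases h2 : ph' α κ β (1/2) ≤ 0
    · exact ⟨1/2, hq, le_rfl, fun u hu => h2, fun u hu => by simp at hu⟩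
    push Not at h1 h2
    obtain ⟨c, hc, he⟩ := intermediate_value_Icc hq (ph'_cont α κ β).continuousOn ⟨h1.le, h2.le⟩
    exact ⟨c, hc.1, hc.2, fun u _ => he.le, fun u _ => he.ge⟩
  set c1 := max p (c - η)
  set c2 := min (1/2) (c + η)
  have o1 : p ≤ c1 := le_max_left _ _
  have o2 : c1 ≤ c := max_le hc1 (by linarith)
  have o3 : c ≤ c2 := le_min hc2 (by linarith)
  have o4 : c2 ≤ 1/2 := min_le_left _ _
  have hwp := ww_pos hp hq
  have B1 : |∫ u in p..c1, ww u * Real.cos (ph α κ β u)| ≤ 5 * ww p / l := by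
    by_cases h : c - η ≤ p
    · have : c1 = p := max_eq_left h
      rw [this]; simp; positivity
    · push Not at h
      have hc1e : c1 = c - η := max_eq_right h.le
      apply FDp hα hp o1 (by linarith) hl0
      right
      intro u hu
      have a := hl1 p ⟨le_rfl, by linarith⟩
      have b := hmono u c (by linarith [hu.1]) (by linarith [hu.2]) hc2
      have : μ * η ≤ μ * (c - u) := by
        apply mul_le_mul_of_nonneg_left _ hμ0.le
        linarith [hu.2]
      linarith
  have B3 : |∫ u in c2..(1/2), ww u * Real.cos (ph α κ β u)| ≤ 5 * ww p / l := by
    by_cases h : 1/2 ≤ c + η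
    · have : c2 = 1/2 := min_eq_left h
      rw [this]; simp; positivity
    · push Not at h
      have hc1e : c2 = c + η := min_eq_right h.le
      have := FDp (β := β) (κ := κ) hα (p := c2) (q := 1/2) (by linarith) o4 le_rfl hl0 (by
        left
        intro u hu
        have a := hr1 (1/2) ⟨by linarith, le_rfl⟩
        have b := hmono c u (by linarith) (by linarith [hu.1]) hu.2
        have : μ * η ≤ μ * (u - c) := by
          apply mul_le_mul_of_nonneg_left _ hμ0.le
          linarith [hu.1]
        linarith)
      refine this.trans ?_
      have := ww_anti hp (o1.trans (o2.trans o3)) o4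
      gcongr
  have B2 : |∫ u in c1..c2, ww u * Real.cos (ph α κ β u)| ≤ 2 * ww p / l := by
    have : ∀ u ∈ Set.uIoc c1 c2, ‖ww u * Real.cos (ph α κ β u)‖ ≤ ww p := by
      intro u hu
      rw [Set.uIoc_of_le (o2.trans o3)] at hu
      have u0 : p ≤ u := by linarith [hu.1]
      have u1 : u ≤ 1/2 := by linarith [hu.2]
      rw [Real.norm_eq_abs, abs_mul, abs_of_pos (ww_pos (by linarith) u1)]
      calc _ ≤ ww p * 1 := by
            gcongr
            · exact ww_anti hp u0 u1
            · exact Real.abs_cos_le_one _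
        _ = _ := mul_one _
    have := intervalIntegral.norm_integral_le_of_norm_le_const this
    rw [Real.norm_eq_abs] at this
    refine this.trans ?_
    rw [abs_of_nonneg (by linarith)]
    have : c2 - c1 ≤ 2 * η := by
      have := min_le_right (1/2) (c + η)
      have := le_max_right p (c - η)
      linarith
    calc _ ≤ ww p * (2 * η) := by gcongr
      _ = _ := by rw [hη]; ring
  have i1 := ww_cos_int hp o1 (by linarith) (ph_cont α κ β)
  have i2 := ww_cos_int (by linarith) (o2.trans o3) o4 (ph_cont α κ β)
  have i3 := ww_cos_int (by linarith) o4 le_rfl (ph_cont α κ β)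
  rw [← intervalIntegral.integral_add_adjacent_intervals (i1.trans i2) i3,
    ← intervalIntegral.integral_add_adjacent_intervals i1 i2]
  have e : 12 * ww p / l = 5 * ww p / l + 2 * ww p / l + 5 * ww p / l := by ring
  rw [e]
  exact (abs_add_le _ _).trans (add_le_add ((abs_add_le _ _).trans (add_le_add B1 B2)) B3)

lemma SD' {κ : ℝ} (hκ : κ ≠ 0) : ∃ C > 0, ∀ α β p : ℝ, 0 < α → 0 < p → p ≤ 1/2 →
    |∫ u in p..(1/2), ww u * Real.cos (ph α κ β u)| ≤ C / (p * √α) := by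
  refine ⟨6 / √(κ ^ 2 * Real.exp (-(|κ|))), by positivity, fun α β p hα hp hq => ?_⟩
  refine (SD hα hκ hp hq).trans ?_
  rw [Real.sqrt_mul hα.le]
  have := ww_le hp hq
  calc _ ≤ 12 * (1 / (2 * p)) / (√α * √(κ ^ 2 * Real.exp (-(|κ|)))) := by gcongr
    _ = _ := by field_simp; norm_num

lemma OUT {κ : ℝ} (hκ : κ ≠ 0) : ∃ C > 0, ∀ α β δ y : ℝ, 0 < α → 0 < δ → δ ≤ 1/2 → 0 < y →
    y ≤ |α * κ + β| →
    |∫ u in δ..(1/2), ww u * Real.cos (ph α κ β u)| ≤ C * (1 / (y * δ) + √α / y) := by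
  obtain ⟨C, hC, hSD⟩ := SD' hκ
  set B := κ ^ 2 * Real.exp (|κ|) with hB
  have hB0 : 0 < B := by positivity
  refine ⟨5 + 2 * B * C, by positivity, fun α β δ y hα hδ hδ2 hy hy2 => ?_⟩
  set u1 := y / (2 * α * B) with hu1
  have hu10 : 0 < u1 := by positivity
  have hgood : ∀ q, q ≤ u1 → q ≤ 1/2 → (∀ u ∈ Set.Icc δ q, y / 2 ≤ ph' α κ β u) ∨
      (∀ u ∈ Set.Icc δ q, ph' α κ β u ≤ -(y/2)) := by
    intro q hq1 hq2
    have key : ∀ u ∈ Set.Icc δ q, |ph' α κ β u - (α * κ + β)| ≤ y / 2 := by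
      intro u hu
      have g := ph'_growth (α := α) (κ := κ) (β := β) (u := 0) (v := u) hα le_rfl
        (by linarith [hu.1]) (by linarith [hu.2])
      have e : ph' α κ β 0 = α * κ + β := by simp [ph']
      rw [e] at g
      have g1 : 0 ≤ α * (κ ^ 2 * Real.exp (-(|κ|))) * (u - 0) := by
        have : 0 ≤ u - 0 := by linarith [hu.1]
        positivity
      have g2 : α * (κ ^ 2 * Real.exp (|κ|)) * (u - 0) ≤ y / 2 := by
        have : u - 0 ≤ u1 := by linarith [hu.2]
        calc _ ≤ α * B * u1 := by rw [← hB]; gcongr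
          _ = _ := by rw [hu1]; field_simp
      rw [abs_le]; constructor <;> linarith [g.1, g.2]
    rcases le_total 0 (α * κ + β) with h | h
    · left; intro u hu
      have := key u hu
      rw [abs_of_nonneg h] at hy2
      rw [abs_le] at this; linarith [this.1]
    · right; intro u hu
      have := key u hu
      rw [abs_of_nonpos h] at hy2
      rw [abs_le] at this; linarith [this.2]
  have F : ∀ q, δ ≤ q → q ≤ u1 → q ≤ 1/2 →
      |∫ u in δ..q, ww u * Real.cos (ph α κ β u)| ≤ 5 * (1 / (y * δ)) := by
    intro q h1 h2 h3
    refine (FDp hα hδ h1 h3 (half_pos hy) (hgood q h2 h3)).trans ?_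
    have := ww_le hδ hδ2
    calc _ ≤ 5 * (1 / (2 * δ)) / (y / 2) := by gcongr
      _ = _ := by field_simp
  have eS : C / (u1 * √α) = 2 * B * C * (√α / y) := by
    rw [hu1]
    have : √α * √α = α := Real.mul_self_sqrt hα.le
    have h0 : 0 < √α := Real.sqrt_pos.2 hα
    field_simp
    nlinarith
  have t1 : 0 < 1 / (y * δ) := by positivity
  have t2 : 0 < √α / y := by positivity
  have fin : 5 * (1 / (y * δ)) + 2 * B * C * (√α / y) ≤ (5 + 2 * B * C) * (1 / (y * δ) + √α / y) := by
    have : 0 < 2 * B * C := by positivity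
    nlinarith
  refine le_trans ?_ fin
  have t3 : 0 ≤ 2 * B * C * (√α / y) := by positivity
  by_cases c1 : 1/2 ≤ u1
  · linarith [F (1/2) hδ2 c1 le_rfl]
  push Not at c1
  by_cases c2 : δ ≤ u1
  · have i1 := ww_cos_int hδ c2 c1.le (ph_cont α κ β)
    have i2 := ww_cos_int hu10 c1.le le_rfl (ph_cont α κ β)
    rw [← intervalIntegral.integral_add_adjacent_intervals i1 i2]
    have a := hSD α β u1 hα hu10 c1.le
    rw [eS] at a
    exact (abs_add_le _ _).trans (add_le_add (F u1 c2 le_rfl c1.le) a)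
  · push Not at c2
    have a := hSD α β δ hα hδ hδ2
    have h0 : 0 < √α := Real.sqrt_pos.2 hα
    have : C / (δ * √α) ≤ C / (u1 * √α) := by gcongr
    linarith

end ZS

namespace ZS
open Real

noncomputable def QF (κ : ℝ) (N : ℕ) (a : ℝ) : ℝ :=
  ∫ u in (-(1/2):ℝ)..(1/2), Real.sin (2 * π * a * Real.exp (κ * u)) * DK N u

lemma sinexp_cont (κ a : ℝ) (N : ℕ) :
    Continuous (fun u => Real.sin (2 * π * a * Real.exp (κ * u)) * DK N u) := by
  have := DK_cont N
  fun_prop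

lemma QF_split (κ : ℝ) (N : ℕ) (a δ : ℝ) :
    QF κ N a = (∫ u in (0:ℝ)..δ, (Real.sin (2 * π * a * Real.exp (κ * u)) +
        Real.sin (2 * π * a * Real.exp (-κ * u))) * DK N u)
      + (∫ u in δ..(1/2), Real.sin (2 * π * a * Real.exp (κ * u)) * DK N u)
      + (∫ u in δ..(1/2), Real.sin (2 * π * a * Real.exp (-κ * u)) * DK N u) := by
  have c1 := sinexp_cont κ a N
  have c2 := sinexp_cont (-κ) a N
  have e1 : QF κ N a = (∫ u in (-(1/2):ℝ)..0, Real.sin (2 * π * a * Real.exp (κ * u)) * DK N u)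
      + ∫ u in (0:ℝ)..(1/2), Real.sin (2 * π * a * Real.exp (κ * u)) * DK N u :=
    (intervalIntegral.integral_add_adjacent_intervals (c1.intervalIntegrable _ _)
      (c1.intervalIntegrable _ _)).symm
  have e2 : (∫ u in (-(1/2):ℝ)..0, Real.sin (2 * π * a * Real.exp (κ * u)) * DK N u)
      = ∫ u in (0:ℝ)..(1/2), Real.sin (2 * π * a * Real.exp (-κ * u)) * DK N u := by
    have := intervalIntegral.integral_comp_neg (a := 0) (b := 1/2)
      (fun u => Real.sin (2 * π * a * Real.exp (κ * u)) * DK N u)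
    rw [neg_zero] at this
    rw [← this]
    simp only [DK_even]
    congr 1; ext u
    rw [neg_mul_comm]
  have e3 := intervalIntegral.integral_add_adjacent_intervals (c1.intervalIntegrable (μ := MeasureTheory.volume) 0 δ)
      (c1.intervalIntegrable δ (1/2))
  have e4 := intervalIntegral.integral_add_adjacent_intervals (c2.intervalIntegrable (μ := MeasureTheory.volume) 0 δ)
      (c2.intervalIntegrable δ (1/2))
  have e5 := intervalIntegral.integral_add (c1.intervalIntegrable (μ := MeasureTheory.volume) 0 δ)
     (c2.intervalIntegrable 0 δ)
  simp only [add_mul]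
  rw [e5, e1, e2, ← e3, ← e4]
  ring

lemma outer_eq (κ : ℝ) (N : ℕ) (a δ : ℝ) (h0 : 0 < δ) (h1 : δ ≤ 1/2) :
    ∫ u in δ..(1/2), Real.sin (2 * π * a * Real.exp (κ * u)) * DK N u
     = (1/2) * ((∫ u in δ..(1/2), ww u * Real.cos (ph (2 * π * a) κ (-((2 * N + 1) * π)) u))
        - ∫ u in δ..(1/2), ww u * Real.cos (ph (2 * π * a) κ ((2 * N + 1) * π) u)) := by
  rw [← intervalIntegral.integral_sub (ww_cos_int h0 h1 le_rfl (ph_cont _ _ _))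
    (ww_cos_int h0 h1 le_rfl (ph_cont _ _ _)), ← intervalIntegral.integral_const_mul]
  apply intervalIntegral.integral_congr
  intro u hu
  rw [Set.uIcc_of_le h1] at hu
  have hs : 0 < Real.sin (π * u) := by
    have := sin_pi_ge (y := u) (by linarith [hu.1]) hu.2
    linarith [hu.1]
  have e : DK N u = ww u * Real.sin ((2 * N + 1) * π * u) := by
    rw [← sin_mul_DK, ww]; field_simp
  simp only [e, ph]
  have e1 : 2 * π * a * Real.exp (κ * u) + -((2 * N + 1) * π) * u
    = 2 * π * a * Real.exp (κ * u) - (2 * N + 1) * π * u := by ring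
  rw [e1, Real.cos_add, Real.cos_sub]
  ring

lemma outer1 {κ : ℝ} (hκ : κ ≠ 0) : ∃ C > 0, ∀ (N : ℕ) (a δ : ℝ), 0 < a → 0 < δ → δ ≤ 1/2 →
    |∫ u in δ..(1/2), Real.sin (2 * π * a * Real.exp (κ * u)) * DK N u| ≤ C / (δ * √a) := by
  obtain ⟨C, hC, h⟩ := SD' hκ
  refine ⟨C, hC, fun N a δ ha h0 h1 => ?_⟩
  rw [outer_eq κ N a δ h0 h1]
  have hπ := Real.pi_gt_three
  have k : C / (δ * √(2 * π * a)) ≤ C / (δ * √a) := by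
    have : √a ≤ √(2 * π * a) := Real.sqrt_le_sqrt (by nlinarith)
    have : 0 < √a := Real.sqrt_pos.2 ha
    gcongr
  have b1 := (h (2 * π * a) (-((2 * N + 1) * π)) δ (by positivity) h0 h1).trans k
  have b2 := (h (2 * π * a) ((2 * N + 1) * π) δ (by positivity) h0 h1).trans k
  rw [abs_le] at *
  constructor <;> linarith [b1.1, b1.2, b2.1, b2.2]

lemma outer2 {κ : ℝ} (hκ : κ ≠ 0) : ∃ C > 0, ∀ (N : ℕ) (a δ x : ℝ), 0 < a → 0 < δ → δ ≤ 1/2 →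
    1 ≤ x → x ≤ |N - a * abs κ| → 
    |∫ u in δ..(1/2), Real.sin (2 * π * a * Real.exp (κ * u)) * DK N u| ≤ C * (1 / (x * δ) + √a / x) := by
  obtain ⟨C, hC, h⟩ := OUT hκ
  refine ⟨C, hC, fun N a δ x ha h0 h1 hx hxN => ?_⟩
  rw [outer_eq κ N a δ h0 h1]
  have hπ := Real.pi_gt_three
  have k : C * (1 / ((π * x) * δ) + √(2 * π * a) / (π * x)) ≤ C * (1 / (x * δ) + √a / x) := by
    have t1 : √(2 * π * a) ≤ π * √a := by
      rw [Real.sqrt_le_left (by positivity), mul_pow, Real.sq_sqrt ha.le]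
      nlinarith [mul_pos Real.pi_pos ha]
    have : x ≤ π * x := by nlinarith
    have t2 : √(2 * π * a) / (π * x) ≤ √a / x := by
      calc _ ≤ π * √a / (π * x) := by gcongr
        _ = _ := by field_simp
    have t3 : 1 / ((π * x) * δ) ≤ 1 / (x * δ) := by gcongr
    exact mul_le_mul_of_nonneg_left (add_le_add t3 t2) hC.le
  have ka : |2 * π * a * κ| = 2 * π * (a * abs κ) := by
    rw [abs_mul, abs_of_pos (by positivity : 0 < 2 * π * a)]; ring
  have kk : π * x ≤ |2 * π * (a * abs κ) - (2 * N + 1) * π| := by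
    have : 2 * π * |N - a * abs κ| - π ≤ |2 * π * (a * abs κ) - (2 * N + 1) * π| := by
      have e : 2 * π * |N - a * abs κ| = |2 * π * (N - a * abs κ)| := by
        rw [abs_mul, abs_of_pos (by positivity : 0 < 2 * π)]
      rw [e]
      have e2 : 2 * π * (a * abs κ) - (2 * N + 1) * π = - (2 * π * (N - a * abs κ)) - π := by ring
      rw [e2]
      have := abs_sub_abs_le_abs_sub (- (2 * π * (N - a * abs κ))) π
      rw [abs_neg, abs_of_pos Real.pi_pos] at this
      exact this
    nlinarith
  have kP : |(2 * (N:ℝ) + 1) * π| = (2 * N + 1) * π := abs_of_pos (by positivity)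
  have k1 : π * x ≤ |2 * π * a * κ + -((2 * N + 1) * π)| := by
    refine kk.trans ?_
    rw [← ka]
    nth_rewrite 1 [← kP]
    rw [← sub_eq_add_neg]
    exact abs_abs_sub_abs_le_abs_sub _ _
  have k2 : π * x ≤ |2 * π * a * κ + ((2 * N + 1) * π)| := by
    refine kk.trans ?_
    rw [← ka]
    nth_rewrite 1 [← kP]
    nth_rewrite 1 [← abs_neg ((2 * (N:ℝ) + 1) * π)]
    nth_rewrite 2 [← neg_neg ((2 * (N:ℝ) + 1) * π)]
    rw [← sub_eq_add_neg]
    exact abs_abs_sub_abs_le_abs_sub _ _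
  have b1 := (h (2 * π * a) (-((2 * N + 1) * π)) δ (π * x) (by positivity) h0 h1 (by positivity) k1).trans k
  have b2 := (h (2 * π * a) ((2 * N + 1) * π) δ (π * x) (by positivity) h0 h1 (by positivity) k2).trans k
  rw [abs_le] at *
  constructor <;> linarith [b1.1, b1.2, b2.1, b2.2]

lemma exp_quad (x : ℝ) : |Real.exp x - (1 + x)| ≤ x ^ 2 * Real.exp |x| := by
  have h := Complex.norm_exp_sub_sum_le_norm_mul_exp (x : ℂ) 2
  simp [Finset.sum_range_succ] at h
  have e : Complex.exp x - (1 + x) = ((Real.exp x - (1 + x) : ℝ) : ℂ) := by push_cast; ring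
  rw [e, Complex.norm_real] at h
  simpa using h

lemma inner1 {κ : ℝ} : ∃ C > 0, ∀ (N : ℕ) (a δ : ℝ), 0 < a → 0 < δ → δ ≤ 1/2 →
    |(∫ u in (0:ℝ)..δ, (Real.sin (2 * π * a * Real.exp (κ * u)) +
        Real.sin (2 * π * a * Real.exp (-κ * u))) * DK N u)
      - Real.sin (2 * π * a) * ∫ u in (0:ℝ)..δ, 2 * Real.cos (2 * π * a * κ * u) * DK N u|
      ≤ C * (a * δ ^ 2) := by
  refine ⟨2 * π * (κ ^ 2 * Real.exp |κ|) + 1, by positivity, fun N a δ ha h0 h1 => ?_⟩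
  have hD := DK_cont N
  rw [← intervalIntegral.integral_const_mul, ← intervalIntegral.integral_sub
    (Continuous.intervalIntegrable (by fun_prop) _ _) (Continuous.intervalIntegrable (by fun_prop) _ _)]
  have : ∀ u ∈ Set.uIoc 0 δ, ‖(Real.sin (2 * π * a * Real.exp (κ * u)) +
        Real.sin (2 * π * a * Real.exp (-κ * u))) * DK N u -
        Real.sin (2 * π * a) * (2 * Real.cos (2 * π * a * κ * u) * DK N u)‖
        ≤ (2 * π * (κ ^ 2 * Real.exp |κ|) + 1) * (a * δ) := by
    intro u hu
    rw [Set.uIoc_of_le h0.le] at hu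
    have hu0 := hu.1
    have hu1 : u ≤ 1/2 := hu.2.trans h1
    have gen : ∀ κ' : ℝ, |κ'| = |κ| → |Real.sin (2 * π * a * Real.exp (κ' * u)) -
        Real.sin (2 * π * a * (1 + κ' * u))| ≤ 2 * π * a * (κ ^ 2 * Real.exp |κ|) * u ^ 2 := by
      intro κ' hk
      refine (Real.abs_sin_sub_sin_le _ _).trans ?_
      rw [← mul_sub, abs_mul, abs_of_pos (by positivity : 0 < 2 * π * a)]
      have := exp_quad (κ' * u)
      have e : (κ' * u) ^ 2 = κ ^ 2 * u ^ 2 := by rw [mul_pow, ← sq_abs κ', hk, sq_abs]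
      have e2 : |κ' * u| ≤ |κ| := by
        rw [abs_mul, hk, abs_of_pos hu0]; nlinarith [abs_nonneg κ]
      rw [e] at this
      calc _ ≤ 2 * π * a * (κ ^ 2 * u ^ 2 * Real.exp |κ|) := by
            gcongr
            exact this.trans (by gcongr)
        _ = _ := by ring
    have g1 := gen κ rfl
    have g2 := gen (-κ) (abs_neg _)
    have hDb := DK_abs_le' N hu0 hu1
    have tr : Real.sin (2 * π * a * (1 + κ * u)) + Real.sin (2 * π * a * (1 + -κ * u))
       = Real.sin (2 * π * a) * (2 * Real.cos (2 * π * a * κ * u)) := by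
      have e1 : 2 * π * a * (1 + κ * u) = 2 * π * a + 2 * π * a * κ * u := by ring
      have e2 : 2 * π * a * (1 + -κ * u) = 2 * π * a - 2 * π * a * κ * u := by ring
      rw [e1, e2, Real.sin_add, Real.sin_sub]; ring
    rw [← mul_assoc, ← tr, ← sub_mul, Real.norm_eq_abs, abs_mul]
    have g3 : |Real.sin (2 * π * a * Real.exp (κ * u)) +
        Real.sin (2 * π * a * Real.exp (-κ * u)) - (Real.sin (2 * π * a * (1 + κ * u)) + Real.sin (2 * π * a * (1 + -κ * u)))|
        ≤ 2 * (2 * π * a * (κ ^ 2 * Real.exp |κ|) * u ^ 2) := by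
      rw [abs_le] at *
      constructor <;> linarith [g1.1, g1.2, g2.1, g2.2]
    calc _ ≤ 2 * (2 * π * a * (κ ^ 2 * Real.exp |κ|) * u ^ 2) * (1 / (2 * u)) := by gcongr
      _ = 2 * π * (κ ^ 2 * Real.exp |κ|) * (a * u) := by field_simp
      _ ≤ 2 * π * (κ ^ 2 * Real.exp |κ|) * (a * δ) := by gcongr; exact hu.2
      _ ≤ _ := by gcongr; linarith
  have := intervalIntegral.norm_integral_le_of_norm_le_const this
  rw [Real.norm_eq_abs] at this
  refine this.trans_eq ?_
  rw [sub_zero, abs_of_pos h0]; ring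

lemma inner2 (N : ℕ) {r δ : ℝ} {b : ℕ} (h0 : 0 < δ) (h1 : δ ≤ 1/2) (hb : |r - b| ≤ 1) :
    |(∫ u in (0:ℝ)..δ, 2 * Real.cos (2 * π * r * u) * DK N u) -
      ∫ u in (0:ℝ)..δ, 2 * Real.cos (2 * π * b * u) * DK N u| ≤ 2 * π * δ := by
  have hD := DK_cont N
  rw [← intervalIntegral.integral_sub
    (Continuous.intervalIntegrable (by fun_prop) _ _) (Continuous.intervalIntegrable (by fun_prop) _ _)]
  have : ∀ u ∈ Set.uIoc 0 δ, ‖2 * Real.cos (2 * π * r * u) * DK N u -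
      2 * Real.cos (2 * π * b * u) * DK N u‖ ≤ 2 * π := by
    intro u hu
    rw [Set.uIoc_of_le h0.le] at hu
    have hu0 := hu.1
    have hu1 : u ≤ 1/2 := hu.2.trans h1
    have hDb := DK_abs_le' N hu0 hu1
    have hc := Real.abs_cos_sub_cos_le (2 * π * r * u) (2 * π * b * u)
    have e : |2 * π * r * u - 2 * π * b * u| ≤ 2 * π * u := by
      have : 2 * π * r * u - 2 * π * b * u = 2 * π * u * (r - b) := by ring
      rw [this, abs_mul, abs_of_pos (by positivity : 0 < 2 * π * u)]
      exact mul_le_of_le_one_right (by positivity) hb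
    rw [← sub_mul, ← mul_sub, Real.norm_eq_abs, abs_mul, abs_mul, abs_two]
    calc _ ≤ 2 * (2 * π * u) * (1 / (2 * u)) := by gcongr; exact hc.trans e
      _ = _ := by field_simp
  have := intervalIntegral.norm_integral_le_of_norm_le_const this
  rw [Real.norm_eq_abs] at this
  refine this.trans_eq ?_
  rw [sub_zero, abs_of_pos h0]

lemma e_bound (j : ℕ) {δ : ℝ} (h0 : 0 < δ) (h1 : δ ≤ 1/2) :
    |(∫ u in (0:ℝ)..δ, DK j u) - 1/2| ≤ 3 ∧ 
    ∀ x : ℝ, 0 < x → x ≤ 2 * j + 1 → |(∫ u in (0:ℝ)..δ, DK j u) - 1/2| ≤ 1 / (x * δ) := by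
  rw [int_DK]
  constructor
  · have := SS_le j δ
    rw [abs_le] at *
    constructor <;> linarith [this.1, this.2]
  · intro x hx hxj
    refine (SS_bound j h0 h1).trans ?_
    gcongr

lemma DK_prod1 {N b : ℕ} (h : b ≤ N) {u : ℝ} (h0 : 0 < u) (h1 : u ≤ 1/2) :
    2 * Real.cos (2 * π * b * u) * DK N u = DK (N + b) u + DK (N - b) u := by
  have hs : 0 < Real.sin (π * u) := by
    have := sin_pi_ge h0.le h1
    linarith
  apply mul_left_cancel₀ hs.ne'
  rw [mul_add, sin_mul_DK, sin_mul_DK, mul_left_comm, sin_mul_DK]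
  push_cast [h]
  have e1 : (2 * ((N:ℝ) + b) + 1) * π * u = (2 * N + 1) * π * u + 2 * π * b * u := by ring
  have e2 : (2 * ((N:ℝ) - b) + 1) * π * u = (2 * N + 1) * π * u - 2 * π * b * u := by ring
  rw [e1, e2, Real.sin_add, Real.sin_sub]; ring

lemma DK_prod2 {N b : ℕ} (h : N + 1 ≤ b) {u : ℝ} (h0 : 0 < u) (h1 : u ≤ 1/2) :
    2 * Real.cos (2 * π * b * u) * DK N u = DK (N + b) u - DK (b - (N + 1)) u := by
  have hs : 0 < Real.sin (π * u) := by
    have := sin_pi_ge h0.le h1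
    linarith
  apply mul_left_cancel₀ hs.ne'
  rw [mul_sub, sin_mul_DK, sin_mul_DK, mul_left_comm, sin_mul_DK]
  push_cast [h]
  have e1 : (2 * ((N:ℝ) + b) + 1) * π * u = 2 * π * b * u + (2 * N + 1) * π * u := by ring
  have e2 : (2 * ((b:ℝ) - (N + 1)) + 1) * π * u = 2 * π * b * u - (2 * N + 1) * π * u := by ring
  rw [e1, e2, Real.sin_add, Real.sin_sub]; ring

lemma inner3 (N : ℕ) {r δ : ℝ} (h0 : 0 < δ) (h1 : δ ≤ 1/2) (hr : 0 ≤ r) :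
    |(∫ u in (0:ℝ)..δ, 2 * Real.cos (2 * π * (⌈r⌉₊:ℕ) * u) * DK N u) - (if r ≤ N then 1 else 0)| ≤ 6 ∧
    ∀ x, 0 < x → x ≤ |N - r| →
    |(∫ u in (0:ℝ)..δ, 2 * Real.cos (2 * π * (⌈r⌉₊:ℕ) * u) * DK N u) - (if r ≤ N then 1 else 0)|
      ≤ 2 * (1 / (x * δ)) := by
  set b := ⌈r⌉₊ with hb
  have hb1 : r ≤ b := Nat.le_ceil r
  have hb2 : (b:ℝ) < r + 1 := Nat.ceil_lt_add_one hr
  have hN0 : (0:ℝ) ≤ N := Nat.cast_nonneg N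
  by_cases h : b ≤ N
  · have h' : r ≤ N := hb1.trans (by exact_mod_cast h)
    have e : ∫ u in (0:ℝ)..δ, 2 * Real.cos (2 * π * b * u) * DK N u =
       (∫ u in (0:ℝ)..δ, DK (N + b) u) + ∫ u in (0:ℝ)..δ, DK (N - b) u := by
      rw [← intervalIntegral.integral_add ((DK_cont _).intervalIntegrable _ _)
        ((DK_cont _).intervalIntegrable _ _)]
      apply intervalIntegral.integral_congr_ae
      filter_upwards with u hu
      rw [Set.uIoc_of_le h0.le] at hu
      exact DK_prod1 h hu.1 (hu.2.trans h1)
    rw [if_pos h', e]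
    obtain ⟨p1, q1⟩ := e_bound (N + b) h0 h1
    obtain ⟨p2, q2⟩ := e_bound (N - b) h0 h1
    constructor
    · rw [abs_le] at *
      constructor <;> linarith [p1.1, p1.2, p2.1, p2.2]
    · intro x hx hxN
      rw [abs_of_nonneg (by linarith)] at hxN
      have hbN : (b:ℝ) ≤ N := by exact_mod_cast h
      have b1 := q1 x hx (by push_cast; linarith)
      have b2 := q2 x hx (by push_cast [h]; linarith)
      rw [abs_le] at *
      constructor <;> linarith [b1.1, b1.2, b2.1, b2.2]
  · push Not at h
    have h' : ¬ r ≤ N := by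
      intro hh
      have := Nat.ceil_le.2 hh
      omega
    have hh : N + 1 ≤ b := h
    have e : ∫ u in (0:ℝ)..δ, 2 * Real.cos (2 * π * b * u) * DK N u =
       (∫ u in (0:ℝ)..δ, DK (N + b) u) - ∫ u in (0:ℝ)..δ, DK (b - (N + 1)) u := by
      rw [← intervalIntegral.integral_sub ((DK_cont _).intervalIntegrable _ _)
        ((DK_cont _).intervalIntegrable _ _)]
      apply intervalIntegral.integral_congr_ae
      filter_upwards with u hu
      rw [Set.uIoc_of_le h0.le] at hu
      exact DK_prod2 hh hu.1 (hu.2.trans h1)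
    rw [if_neg h', e]
    obtain ⟨p1, q1⟩ := e_bound (N + b) h0 h1
    obtain ⟨p2, q2⟩ := e_bound (b - (N + 1)) h0 h1
    constructor
    · rw [abs_le] at *
      constructor <;> linarith [p1.1, p1.2, p2.1, p2.2]
    · intro x hx hxN
      push Not at h'
      rw [abs_of_nonpos (by linarith)] at hxN
      have hbN : (N:ℝ) + 1 ≤ b := by exact_mod_cast hh
      have b1 := q1 x hx (by push_cast; linarith)
      have b2 := q2 x hx (by push_cast [hh]; linarith)
      rw [abs_le] at *
      constructor <;> linarith [b1.1, b1.2, b2.1, b2.2]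

lemma innerQ {κ : ℝ} (hκ : 0 < κ) : ∃ C > 0, ∀ (N : ℕ) (a δ : ℝ), 0 < a → 0 < δ → δ ≤ 1/2 →
    |(∫ u in (0:ℝ)..δ, (Real.sin (2 * π * a * Real.exp (κ * u)) +
        Real.sin (2 * π * a * Real.exp (-κ * u))) * DK N u)
      - Real.sin (2 * π * a) * (if a * κ ≤ N then 1 else 0)| ≤ C * (a * δ ^ 2 + 1) ∧
    ∀ x, 0 < x → x ≤ |N - a * κ| →
    |(∫ u in (0:ℝ)..δ, (Real.sin (2 * π * a * Real.exp (κ * u)) +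
        Real.sin (2 * π * a * Real.exp (-κ * u))) * DK N u)
      - Real.sin (2 * π * a) * (if a * κ ≤ N then 1 else 0)| ≤ C * (a * δ ^ 2 + δ + 1 / (x * δ)) := by
  obtain ⟨C, hC, h⟩ := inner1 (κ := κ)
  refine ⟨C + 2 * π + 6, by positivity, fun N a δ ha h0 h1 => ?_⟩
  have hr : 0 ≤ a * κ := by positivity
  have i1 := h N a δ ha h0 h1
  have i2 := inner2 N (r := a * κ) (b := ⌈a * κ⌉₊) h0 h1 (by
    rw [abs_le]; constructor <;> linarith [Nat.le_ceil (a * κ), Nat.ceil_lt_add_one hr])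
  obtain ⟨i3, i4⟩ := inner3 N h0 h1 hr
  rw [← mul_assoc (2 * π) a κ] at i2
  set J := ∫ u in (0:ℝ)..δ, (Real.sin (2 * π * a * Real.exp (κ * u)) +
        Real.sin (2 * π * a * Real.exp (-κ * u))) * DK N u
  set K := ∫ u in (0:ℝ)..δ, 2 * Real.cos (2 * π * a * κ * u) * DK N u
  set L := ∫ u in (0:ℝ)..δ, 2 * Real.cos (2 * π * (⌈a * κ⌉₊:ℕ) * u) * DK N u
  set t : ℝ := if a * κ ≤ N then 1 else 0
  have key : ∀ e, |L - t| ≤ e → |J - Real.sin (2 * π * a) * t| ≤ C * (a * δ ^ 2) + 2 * π * δ + e := by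
    intro e he
    have hs := Real.abs_sin_le_one (2 * π * a)
    have e1 : J - Real.sin (2 * π * a) * t = (J - Real.sin (2 * π * a) * K) + Real.sin (2 * π * a) * ((K - L) + (L - t)) := by ring
    rw [e1]
    refine (abs_add_le _ _).trans ?_
    rw [abs_mul, add_assoc]
    refine add_le_add i1 ?_
    calc _ ≤ 1 * |(K - L) + (L - t)| := by gcongr
      _ ≤ _ := by rw [one_mul]; exact (abs_add_le _ _).trans (add_le_add i2 he)
  have hπ := Real.pi_pos
  have p1 : 0 < a * δ ^ 2 := by positivity
  constructor
  · refine (key _ i3).trans ?_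
    nlinarith
  · intro x hx hxN
    refine (key _ (i4 x hx hxN)).trans ?_
    have p2 : 0 < 1 / (x * δ) := by positivity
    have := mul_pos hC h0
    have := mul_pos hC p2
    have := mul_pos hπ p2
    have := mul_pos hπ p1
    nlinarith

lemma lemmaQ {κ c : ℝ} (hκ : 0 < κ) (hc : 0 < c) : ∃ C > 0, ∀ (N : ℕ) (a : ℝ), c ≤ a → 
    |QF κ N a - Real.sin (2 * π * a) * (if a * κ ≤ N then 1 else 0)| ≤ C ∧
    |QF κ N a - Real.sin (2 * π * a) * (if a * κ ≤ N then 1 else 0)| * |N - a * κ|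
      ≤ C * (a + N + 1) ^ ((2:ℝ)/3) := by
  obtain ⟨C1, hC1, h1⟩ := innerQ hκ
  obtain ⟨C2, hC2, h2⟩ := outer1 hκ.ne'
  obtain ⟨C3, hC3, h3⟩ := outer1 (neg_ne_zero.2 hκ.ne')
  obtain ⟨C4, hC4, h4⟩ := outer2 hκ.ne'
  obtain ⟨C5, hC5, h5⟩ := outer2 (neg_ne_zero.2 hκ.ne')
  -- first bound
  have B1 : ∃ C > 0, ∀ (N : ℕ) (a : ℝ), c ≤ a → 
    |QF κ N a - Real.sin (2 * π * a) * (if a * κ ≤ N then 1 else 0)| ≤ C := by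
    refine ⟨C1 * 2 + (C2 + C3) * (2 * √(1 + 1/c)), by positivity, fun N a ha => ?_⟩
    have ha0 : 0 < a := hc.trans_le ha
    have hq : 1 ≤ √(a + 1) := by rw [Real.one_le_sqrt]; linarith
    set δ := 1 / (2 * √(a+1)) with hδ
    have d0 : 0 < δ := by positivity
    have d1 : δ ≤ 1/2 := by
      rw [hδ]; gcongr; linarith
    have d2 : a * δ ^ 2 ≤ 1 := by
      rw [hδ, div_pow, mul_pow, Real.sq_sqrt (by linarith), one_pow, mul_one_div, div_le_one (by positivity)]
      linarith
    have d3 : 1 / (δ * √a) ≤ 2 * √(1 + 1/c) := by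
      have : 1 / (δ * √a) = 2 * √(1 + 1/a) := by
        have e : 1 + 1 / a = (a + 1) / a := by field_simp
        rw [e, Real.sqrt_div (by linarith), hδ]
        field_simp
      rw [this]
      gcongr
    have i1 := (h1 N a δ ha0 d0 d1).1
    have i2 := h2 N a δ ha0 d0 d1
    have i3 := h3 N a δ ha0 d0 d1
    have j1 : C1 * (a * δ ^ 2 + 1) ≤ C1 * 2 := by gcongr; linarith
    have j2 : C2 / (δ * √a) ≤ C2 * (2 * √(1 + 1/c)) := by
      rw [← mul_one_div]; gcongr
    have j3 : C3 / (δ * √a) ≤ C3 * (2 * √(1 + 1/c)) := by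
      rw [← mul_one_div]; gcongr
    rw [QF_split κ N a δ]
    rw [abs_le] at *
    constructor <;> linarith [i1.1, i1.2, i2.1, i2.2, i3.1, i3.2]
  obtain ⟨C, hC, B1⟩ := B1
  refine ⟨C + C1 * ((1 + κ) * 2 + 2) + (C4 + C5) * 3, by positivity, fun N a ha => ?_⟩
  have ha0 : 0 < a := hc.trans_le ha
  have b1 := B1 N a ha
  have hE : 0 ≤ C1 * ((1 + κ) * 2 + 2) + (C4 + C5) * 3 := by positivity
  refine ⟨b1.trans (by linarith), ?_⟩
  set A := a + N + 1 with hA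
  have hN0 : (0:ℝ) ≤ N := Nat.cast_nonneg N
  have hA1 : 1 ≤ A := by linarith
  have hA0 : 0 < A := by linarith
  have hA3 : 1 ≤ A ^ ((2:ℝ)/3) := Real.one_le_rpow hA1 (by norm_num)
  set x := |N - a * κ| with hx
  by_cases hx1 : x < 1
  · calc _ ≤ C * 1 := by gcongr
      _ ≤ (C + C1 * ((1 + κ) * 2 + 2) + (C4 + C5) * 3) * A ^ ((2:ℝ)/3) := by
        gcongr; linarith
  push Not at hx1
  have hx0 : 0 < x := by linarith
  set δ := 1 / (2 * A ^ ((2:ℝ)/3)) with hδ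
  have d0 : 0 < δ := by positivity
  have d1 : δ ≤ 1/2 := by
    rw [hδ]; gcongr; linarith
  have i1 := (h1 N a δ ha0 d0 d1).2 x hx0 le_rfl
  have i2 := h4 N a δ x ha0 d0 d1 hx1 (by rw [abs_of_pos hκ])
  have i3 := h5 N a δ x ha0 d0 d1 hx1 (by rw [abs_neg, abs_of_pos hκ])
  have tot : |QF κ N a - Real.sin (2 * π * a) * (if a * κ ≤ N then 1 else 0)| ≤
     C1 * (a * δ ^ 2 + δ + 1 / (x * δ)) + (C4 + C5) * (1 / (x * δ) + √a / x) := by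
    rw [QF_split κ N a δ]
    rw [abs_le] at *
    constructor <;> linarith [i1.1, i1.2, i2.1, i2.2, i3.1, i3.2]
  have hxA : x ≤ (1 + κ) * A := by
    rw [hx, abs_le]
    constructor <;> nlinarith
  have hpow : A = A ^ ((1:ℝ)/3) * A ^ ((2:ℝ)/3) := by
    rw [← Real.rpow_add hA0]; norm_num
  have k1 : a * δ ^ 2 * x ≤ (1 + κ) * A ^ ((2:ℝ)/3) := by
    have : a * δ ≤ A ^ ((1:ℝ)/3) := by
      have : A * δ = A ^ ((1:ℝ)/3) / 2 := by
        nth_rewrite 1 [hpow]; rw [hδ]; field_simp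
      have h' : 0 < A ^ ((1:ℝ)/3) := by positivity
      nlinarith
    have h2 : δ * x ≤ (1 + κ) * A ^ ((1:ℝ)/3) := by
      have : A * δ = A ^ ((1:ℝ)/3) / 2 := by
        nth_rewrite 1 [hpow]; rw [hδ]; field_simp
      have h' : 0 < A ^ ((1:ℝ)/3) := by positivity
      calc δ * x ≤ δ * ((1 + κ) * A) := by gcongr
        _ = (1 + κ) * (A ^ ((1:ℝ)/3) / 2) := by rw [← this]; ring
        _ ≤ _ := by gcongr; linarith
    calc a * δ ^ 2 * x = (a * δ) * (δ * x) := by ring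
      _ ≤ A ^ ((1:ℝ)/3) * ((1 + κ) * A ^ ((1:ℝ)/3)) := by gcongr
      _ = (1 + κ) * A ^ ((2:ℝ)/3) := by
        rw [mul_left_comm, ← Real.rpow_add hA0]; norm_num
  have k2 : δ * x ≤ (1 + κ) * A ^ ((2:ℝ)/3) := by
    have : A * δ ≤ A ^ ((2:ℝ)/3) := by
      have : A * δ = A ^ ((1:ℝ)/3) / 2 := by
        nth_rewrite 1 [hpow]; rw [hδ]; field_simp
      have h' : A ^ ((1:ℝ)/3) ≤ A ^ ((2:ℝ)/3) := Real.rpow_le_rpow_of_exponent_le hA1 (by norm_num)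
      have h'' : 0 < A ^ ((1:ℝ)/3) := by positivity
      linarith
    calc δ * x ≤ δ * ((1 + κ) * A) := by gcongr
      _ = (1 + κ) * (A * δ) := by ring
      _ ≤ _ := by gcongr
  have k3 : 1 / (x * δ) * x = 2 * A ^ ((2:ℝ)/3) := by
    rw [hδ]; field_simp
  have k4 : √a / x * x ≤ A ^ ((2:ℝ)/3) := by
    rw [div_mul_cancel₀ _ hx0.ne']
    calc √a ≤ √A := Real.sqrt_le_sqrt (by linarith)
      _ = A ^ ((1:ℝ)/2) := Real.sqrt_eq_rpow A
      _ ≤ _ := Real.rpow_le_rpow_of_exponent_le hA1 (by norm_num)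
  calc _ ≤ (C1 * (a * δ ^ 2 + δ + 1 / (x * δ)) + (C4 + C5) * (1 / (x * δ) + √a / x)) * x := by gcongr
    _ = C1 * (a * δ ^ 2 * x + δ * x + 1 / (x * δ) * x) + (C4 + C5) * (1 / (x * δ) * x + √a / x * x) := by ring
    _ ≤ C1 * ((1 + κ) * A ^ ((2:ℝ)/3) + (1 + κ) * A ^ ((2:ℝ)/3) + 2 * A ^ ((2:ℝ)/3))
       + (C4 + C5) * (2 * A ^ ((2:ℝ)/3) + A ^ ((2:ℝ)/3)) := by
        rw [k3]; gcongr
    _ = (0 + C1 * ((1 + κ) * 2 + 2) + (C4 + C5) * 3) * A ^ ((2:ℝ)/3) := by ring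
    _ ≤ _ := by gcongr

end ZS

namespace ZS
open Real

noncomputable def IF (κ : ℝ) (N : ℕ) (X : ℝ) : ℝ :=
  ∫ u in (-(1/2):ℝ)..(1/2), sw (X * Real.exp (κ * u)) * DK N u

lemma QF_sum (κ : ℝ) (N R : ℕ) (X : ℝ) :
    ∑ m ∈ Finset.Icc 1 R, QF κ N (m * X) / (m * π)
     = ∫ u in (-(1/2):ℝ)..(1/2), SS R (X * Real.exp (κ * u)) * DK N u := by
  unfold QF SS
  simp_rw [Finset.sum_mul]
  rw [intervalIntegral.integral_finsetSum]
  · apply Finset.sum_congr rfl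
    intro m _
    rw [← intervalIntegral.integral_div]
    congr 1; ext u
    have : 2 * π * (m * X) * Real.exp (κ * u) = 2 * π * m * (X * Real.exp (κ * u)) := by ring
    rw [this]; ring
  · intro m _
    have := DK_cont N
    exact Continuous.intervalIntegrable (by fun_prop) _ _

lemma IF_lim {κ : ℝ} (hκ : 0 < κ) (N : ℕ) {X : ℝ} (hX : 0 < X) :
    Filter.Tendsto (fun R : ℕ => ∑ m ∈ Finset.Icc 1 R, QF κ N (m * X) / (m * π)) Filter.atTop
      (nhds (-IF κ N X)) := by
  simp_rw [QF_sum]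
  have e : -IF κ N X = ∫ u in (-(1/2):ℝ)..(1/2), (- sw (X * Real.exp (κ * u))) * DK N u := by
    unfold IF; rw [← intervalIntegral.integral_neg]; congr 1; ext u; ring
  rw [e]
  have hD := DK_cont N
  apply intervalIntegral.tendsto_integral_filter_of_dominated_convergence (fun _ => 2 * (2 * (N:ℝ) + 1))
  · filter_upwards with R
    have := SS_cont R
    exact (Continuous.aestronglyMeasurable (by fun_prop))
  · filter_upwards with R
    filter_upwards with u _
    rw [Real.norm_eq_abs, abs_mul]
    gcongr
    · exact SS_le _ _
    · exact DK_abs_le _ _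
  · exact intervalIntegrable_const
  · have hc : Set.Countable {u : ℝ | Int.fract (X * Real.exp (κ * u)) = 0} := by
      apply (Set.countable_range (fun k : ℤ => Real.log ((k:ℝ) / X) / κ)).mono
      intro u hu
      rw [Set.mem_ofPred_eq, Int.fract, sub_eq_zero] at hu
      refine ⟨⌊X * Real.exp (κ * u)⌋, ?_⟩
      simp only
      rw [← hu, mul_div_cancel_left₀ _ hX.ne', Real.log_exp, mul_div_cancel_left₀ _ hκ.ne']
    filter_upwards [hc.ae_notMem MeasureTheory.volume] with u hu _
    exact (SS_tendsto hu).mul_const _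

noncomputable def gg (j : ℤ) : ℝ := ((|(j:ℝ)| + 1) / 8) ^ (-(4/3) : ℝ)

lemma gg_pos (j : ℤ) : 0 < gg j := by unfold gg; positivity

lemma gg_summable : Summable gg := by
  have h : Summable (fun n : ℕ => gg n) := by
    unfold gg
    have h1 : Summable (fun n : ℕ => ((n:ℝ)) ^ (-(4/3) : ℝ)) := Real.summable_nat_rpow.2 (by norm_num)
    have h2 := ((summable_nat_add_iff 1).2 h1).mul_right ((8:ℝ) ^ (-(4/3) : ℝ))⁻¹
    refine h2.congr fun n => ?_
    rw [Real.div_rpow (by positivity) (by positivity)]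
    push_cast
    rw [Nat.abs_cast]; rfl
  rw [summable_int_iff_summable_nat_and_neg]
  refine ⟨h, h.congr fun n => ?_⟩
  simp [gg]

lemma sum_shift {g : ℤ → ℝ} (hg : Summable g) (h0 : ∀ j, 0 ≤ g j) (k : ℤ) (S : Finset ℤ) :
    ∑ m ∈ S, g (m - k) ≤ ∑' j, g j := by
  have hs : Summable (fun m : ℤ => g (m - k)) := hg.comp_injective (sub_left_injective)
  refine (hs.sum_le_tsum S (fun i _ => h0 _)).trans_eq ?_
  exact (Equiv.subRight k).tsum_eq g

lemma sum_shift_nat {g : ℤ → ℝ} (hg : Summable g) (h0 : ∀ j, 0 ≤ g j) (k : ℤ) (S : Finset ℕ) :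
    ∑ m ∈ S, g ((m:ℤ) - k) ≤ ∑' j, g j := by
  have := sum_shift hg h0 k (S.map Nat.castEmbedding)
  simpa using this

noncomputable def nu (x : ℝ) : ℝ := if 1/2 < x then 1 / x else 0

lemma nu_nonneg (x : ℝ) : 0 ≤ nu x := by
  unfold nu; split_ifs with h
  · have : 0 < x := by linarith
    positivity
  · rfl

lemma far_gg {m : ℕ} {x : ℝ} (h : 1/2 ≤ |m - x|) :
    (|m - x|) ^ (-(4/3) : ℝ) ≤ gg (m - ⌊x⌋) := by
  unfold gg
  apply Real.rpow_le_rpow_of_nonpos (by positivity) _ (by norm_num)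
  push_cast
  have h1 := Int.floor_le x
  have h2 := Int.lt_floor_add_one x
  rcases le_or_gt (m:ℤ) ⌊x⌋ with hm | hm
  · have hm' : (m:ℝ) ≤ ⌊x⌋ := by exact_mod_cast hm
    rw [abs_of_nonpos (by linarith)] at h ⊢
    rw [abs_of_nonpos (by linarith)]
    linarith
  · have hm' : (⌊x⌋:ℝ) + 1 ≤ m := by exact_mod_cast hm
    rw [abs_of_nonneg (by linarith)] at h ⊢
    rw [abs_of_nonneg (by linarith)]
    linarith

lemma near_gg {m : ℕ} {x : ℝ} (h : |m - x| < 1/2) : 1 ≤ gg (m - ⌊x⌋) := by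
  unfold gg
  apply Real.one_le_rpow_of_pos_of_le_one_of_nonpos (by positivity) _ (by norm_num)
  push_cast
  have h1 := Int.floor_le x
  have h2 := Int.lt_floor_add_one x
  rw [div_le_one (by norm_num)]
  have : |(m:ℝ) - ⌊x⌋| ≤ 3 := by
    rw [abs_lt] at h
    rw [abs_le]; constructor <;> linarith [h.1, h.2]
  linarith

lemma young {p q : ℝ} (hp : 0 ≤ p) (hq : 0 ≤ q) : p * q ^ 3 ≤ p ^ 4 + q ^ 4 := by
  nlinarith [sq_nonneg (p - q), sq_nonneg (p^2 - q^2), mul_nonneg hp hq, mul_nonneg (mul_nonneg hp hq) (sq_nonneg (p - q)), sq_nonneg (p*q - q^2), sq_nonneg (p*q-p^2)]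

lemma far_alg {m y : ℝ} (hm : 0 < m) (hy : 0 < y) :
    (2 * m + y) ^ ((2:ℝ)/3) / (m * y) ≤ 3 * (m ^ (-(4/3):ℝ) + y ^ (-(4/3):ℝ)) := by
  set p := m ^ (-(1/3):ℝ) with hp
  set q := y ^ (-(1/3):ℝ) with hq
  have p0 : 0 < p := by positivity
  have q0 : 0 < q := by positivity
  have pn : ∀ k : ℕ, ∀ z : ℝ, 0 < z → (z ^ (-(1/3):ℝ)) ^ k = z ^ (-(k/3:ℝ)) := by
    intro k z hz
    rw [← Real.rpow_natCast, ← Real.rpow_mul hz.le]; congr 1; ring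
  have e1 : m ^ (-(4/3):ℝ) = p ^ 4 := by rw [hp, pn 4 m hm]; norm_num
  have e2 : y ^ (-(4/3):ℝ) = q ^ 4 := by rw [hq, pn 4 y hy]; norm_num
  have e3 : m ^ ((2:ℝ)/3) / m = p := by
    rw [hp]; nth_rewrite 2 [← Real.rpow_one m]; rw [← Real.rpow_sub hm]; norm_num
  have e4 : y ^ ((2:ℝ)/3) / y = q := by
    rw [hq]; nth_rewrite 2 [← Real.rpow_one y]; rw [← Real.rpow_sub hy]; norm_num
  have e5 : 1 / m = p ^ 3 := by rw [hp, pn 3 m hm]; norm_num [Real.rpow_neg_one]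
  have e6 : 1 / y = q ^ 3 := by rw [hq, pn 3 y hy]; norm_num [Real.rpow_neg_one]
  have h1 : (2 * m + y) ^ ((2:ℝ)/3) ≤ 2 * m ^ ((2:ℝ)/3) + y ^ ((2:ℝ)/3) := by
    refine (Real.rpow_add_le_add_rpow (by positivity) (by positivity) (by norm_num) (by norm_num)).trans ?_
    rw [Real.mul_rpow (by norm_num) hm.le]
    have : (2:ℝ) ^ ((2:ℝ)/3) ≤ 2 ^ (1:ℝ) := Real.rpow_le_rpow_of_exponent_le (by norm_num) (by norm_num)
    rw [Real.rpow_one] at this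
    gcongr
  rw [e1, e2]
  calc _ ≤ (2 * m ^ ((2:ℝ)/3) + y ^ ((2:ℝ)/3)) / (m * y) := by gcongr
    _ = 2 * ((m ^ ((2:ℝ)/3) / m) * (1 / y)) + (y ^ ((2:ℝ)/3) / y) * (1 / m) := by field_simp
    _ = 2 * (p * q ^ 3) + q * p ^ 3 := by rw [e3, e4, e5, e6]
    _ ≤ _ := by linarith [young p0.le q0.le, young q0.le p0.le]

lemma termQ {κ c : ℝ} (hκ : 0 < κ) (hc : 0 < c) : ∃ C > 0, ∀ (N m : ℕ) (X : ℝ), c ≤ X → 1 ≤ m →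
    |QF κ N (m * X) - Real.sin (2 * π * (m * X)) * (if m * X * κ ≤ N then 1 else 0)| / m
     ≤ C * (X ^ (-(1/3):ℝ) * ((m:ℝ) ^ (-(4/3):ℝ) + gg (m - ⌊N / (κ * X)⌋)) +
        nu (N / (κ * X)) * gg (m - ⌊N / (κ * X)⌋)) := by
  obtain ⟨C, hC, h⟩ := lemmaQ hκ hc
  set D := (1 + κ + 1 / c) with hD
  have hD0 : 0 < D := by positivity
  refine ⟨C * D ^ ((2:ℝ)/3) / κ * 3 + 2 * C, by positivity, fun N m X hX hm => ?_⟩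
  have hX0 : 0 < X := hc.trans_le hX
  have hm1 : (1:ℝ) ≤ m := by exact_mod_cast hm
  obtain ⟨h1, h2⟩ := h N (m * X) (by nlinarith)
  set E := |QF κ N (m * X) - Real.sin (2 * π * (m * X)) * (if m * X * κ ≤ N then 1 else 0)| with hE
  set x := N / (κ * X) with hx
  have hN : (N:ℝ) = κ * X * x := by rw [hx]; field_simp
  have hx0 : 0 ≤ x := by positivity
  have g0 := gg_pos (m - ⌊x⌋)
  have n0 := nu_nonneg x
  have E0 : 0 ≤ E := abs_nonneg _
  by_cases hf : |m - x| < 1/2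
  · have g1 := near_gg hf
    have hxx : 1/2 < x := by rw [abs_lt] at hf; linarith [hf.2]
    have : nu x = 1 / x := if_pos hxx
    have k : 1 / (m:ℝ) ≤ 2 * nu x := by
      rw [this]
      have : x ≤ 2 * m := by rw [abs_lt] at hf; linarith [hf.1]
      calc 1 / (m:ℝ) = 2 * (1 / (2 * m)) := by field_simp
        _ ≤ _ := by gcongr
    calc E / m = E * (1 / m) := by ring
      _ ≤ C * (2 * nu x) := by gcongr
      _ = 0 + 2 * C * (nu x * 1) := by ring
      _ ≤ (C * D ^ ((2:ℝ)/3) / κ * 3 + 2 * C) * (X ^ (-(1/3):ℝ) * ((m:ℝ) ^ (-(4/3):ℝ) + gg (m - ⌊x⌋))) +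
         (C * D ^ ((2:ℝ)/3) / κ * 3 + 2 * C) * (nu x * gg (m - ⌊x⌋)) := by
          have : 0 ≤ C * D ^ ((2:ℝ)/3) / κ * 3 := by positivity
          gcongr
          · positivity
          · linarith
      _ = _ := by ring
  · push Not at hf
    have g1 := far_gg hf
    set y := |m - x| with hy
    have hy0 : 0 < y := by linarith
    have e1 : |N - m * X * κ| = κ * X * y := by
      have : (N:ℝ) - m * X * κ = - (κ * X * (m - x)) := by rw [hN]; ring
      rw [this, abs_neg, abs_mul, abs_of_pos (by positivity)]
    have hA : m * X + N + 1 ≤ D * (X * (2 * m + y)) := by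
      have a1 : x ≤ m + y := by rw [hy]; linarith [neg_abs_le (m - x)]
      have a2 : 1 ≤ 1 / c * (X * m) := by
        rw [one_div, inv_mul_eq_div, le_div_iff₀ hc]; nlinarith
      have a3 : 0 ≤ 1 / c * (X * (m + y)) := by positivity
      have a4 : κ * X * x ≤ κ * X * (m + y) := by gcongr
      have a5 : 0 ≤ X * (m + y) := by positivity
      have a6 : 0 ≤ κ * X * m := by positivity
      rw [hN, hD]
      nlinarith
    rw [e1] at h2
    have h3 : E * (κ * X * y) ≤ C * (D ^ ((2:ℝ)/3) * (X ^ ((2:ℝ)/3) * (2 * m + y) ^ ((2:ℝ)/3))) := by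
      rw [← Real.mul_rpow hX0.le (by positivity), ← Real.mul_rpow hD0.le (by positivity)]
      refine h2.trans ?_
      gcongr
    have h4 : E / m ≤ C * D ^ ((2:ℝ)/3) / κ * (X ^ (-(1/3):ℝ) * ((2 * m + y) ^ ((2:ℝ)/3) / (m * y))) := by
      have e4 : X ^ ((2:ℝ)/3) = X ^ (-(1/3):ℝ) * X := by
        nth_rewrite 3 [← Real.rpow_one X]; rw [← Real.rpow_add hX0]; norm_num
      rw [e4] at h3
      rw [div_le_iff₀ (by linarith)]
      have : E = E * (κ * X * y) / (κ * X * y) := by field_simp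
      rw [this, div_le_iff₀ (by positivity)]
      refine h3.trans_eq ?_
      field_simp
    calc E / m ≤ _ := h4
      _ ≤ C * D ^ ((2:ℝ)/3) / κ * (X ^ (-(1/3):ℝ) * (3 * ((m:ℝ) ^ (-(4/3):ℝ) + y ^ (-(4/3):ℝ)))) := by
        gcongr; exact far_alg (by linarith) hy0
      _ ≤ C * D ^ ((2:ℝ)/3) / κ * (X ^ (-(1/3):ℝ) * (3 * ((m:ℝ) ^ (-(4/3):ℝ) + gg (m - ⌊x⌋)))) := by
        gcongr
      _ = (C * D ^ ((2:ℝ)/3) / κ * 3) * (X ^ (-(1/3):ℝ) * ((m:ℝ) ^ (-(4/3):ℝ) + gg (m - ⌊x⌋)) + 0) := by ring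
      _ ≤ _ := by
        gcongr
        · linarith
        · positivity

lemma IF_bound {κ c : ℝ} (hκ : 0 < κ) (hc : 0 < c) : ∃ C > 0, ∀ (N : ℕ) (X : ℝ), c ≤ X →
    |IF κ N X + SS ⌊N / (κ * X)⌋₊ X| ≤ C * (X ^ (-(1/3):ℝ) + nu (N / (κ * X))) := by
  obtain ⟨C, hC, h⟩ := termQ hκ hc
  have s1 : Summable (fun n : ℕ => ((n:ℝ)) ^ (-(4/3) : ℝ)) := Real.summable_nat_rpow.2 (by norm_num)
  set T := ∑' n : ℕ, ((n:ℝ)) ^ (-(4/3) : ℝ) with hT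
  set G := ∑' j, gg j with hG
  have T0 : 0 ≤ T := tsum_nonneg fun n => by positivity
  have G0 : 0 ≤ G := tsum_nonneg fun n => (gg_pos n).le
  refine ⟨C * (T + G) + 1, by positivity, fun N X hX => ?_⟩
  have hX0 : 0 < X := hc.trans_le hX
  set x := N / (κ * X) with hx
  have hx0 : 0 ≤ x := by positivity
  have n0 := nu_nonneg x
  have lim := (IF_lim hκ N hX0).sub_const (SS ⌊x⌋₊ X)
  have lim2 := lim.abs
  have e : |IF κ N X + SS ⌊x⌋₊ X| = |-IF κ N X - SS ⌊x⌋₊ X| := by rw [← abs_neg]; congr 1; ring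
  rw [e]
  refine le_of_tendsto lim2 ?_
  filter_upwards [Filter.eventually_ge_atTop ⌊x⌋₊] with R hR
  have es : SS ⌊x⌋₊ X = ∑ m ∈ Finset.Icc 1 R,
      (Real.sin (2 * π * (m * X)) * (if m * X * κ ≤ N then 1 else 0)) / (m * π) := by
    unfold SS
    have hsub : Finset.Icc 1 ⌊x⌋₊ ⊆ Finset.Icc 1 R := Finset.Icc_subset_Icc_right hR
    have hiff : ∀ m : ℕ, (m * X * κ ≤ N ↔ m ≤ ⌊x⌋₊) := by
      intro m
      rw [Nat.le_floor_iff hx0, hx, le_div_iff₀ (by positivity)]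
      rw [show (m:ℝ) * X * κ = m * (κ * X) by ring]
    rw [← Finset.sum_subset hsub]
    · apply Finset.sum_congr rfl
      intro m hm
      rw [if_pos ((hiff m).2 (Finset.mem_Icc.1 hm).2), mul_one, mul_assoc (2 * π)]
    · intro m hm hm'
      rw [if_neg]
      · simp
      · rw [hiff]
        intro hle
        exact hm' (Finset.mem_Icc.2 ⟨(Finset.mem_Icc.1 hm).1, hle⟩)
  rw [es, ← Finset.sum_sub_distrib]
  refine (Finset.abs_sum_le_sum_abs _ _).trans ?_
  have b1 : ∑ m ∈ Finset.Icc 1 R, |QF κ N (m * X) / (m * π) -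
      Real.sin (2 * π * (m * X)) * (if m * X * κ ≤ N then 1 else 0) / (m * π)| ≤
      ∑ m ∈ Finset.Icc 1 R, C * (X ^ (-(1/3):ℝ) * ((m:ℝ) ^ (-(4/3):ℝ) + gg (m - ⌊x⌋)) +
        nu x * gg (m - ⌊x⌋)) := by
    apply Finset.sum_le_sum
    intro m hm
    have hm1 := (Finset.mem_Icc.1 hm).1
    have hm0 : (0:ℝ) < m := by exact_mod_cast hm1
    refine le_trans ?_ (h N m X hX hm1)
    rw [← sub_div, abs_div, abs_of_pos (by positivity : (0:ℝ) < m * π)]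
    gcongr
    nlinarith [Real.pi_gt_three]
  refine b1.trans ?_
  have c1 : ∑ m ∈ Finset.Icc 1 R, (m:ℝ) ^ (-(4/3):ℝ) ≤ T := s1.sum_le_tsum _ (fun i _ => by positivity)
  have c2 : ∑ m ∈ Finset.Icc 1 R, gg (m - ⌊x⌋) ≤ G := sum_shift_nat gg_summable (fun j => (gg_pos j).le) _ _
  rw [← Finset.mul_sum, Finset.sum_add_distrib, ← Finset.mul_sum, ← Finset.mul_sum, Finset.sum_add_distrib]
  have hXp : 0 < X ^ (-(1/3):ℝ) := by positivity
  calc _ ≤ C * (X ^ (-(1/3):ℝ) * (T + G) + nu x * G) := by gcongr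
    _ ≤ C * (X ^ (-(1/3):ℝ) * (T + G) + nu x * (T + G)) := by gcongr; linarith
    _ = (C * (T + G)) * (X ^ (-(1/3):ℝ) + nu x) := by ring
    _ ≤ _ := by gcongr; linarith

end ZS

namespace ZS
open Real

lemma expabs_summable {r : ℝ} (hr : 0 < r) : Summable (fun j : ℤ => Real.exp (-(r * |(j:ℝ)|))) := by
  have h : Summable (fun n : ℕ => Real.exp (-(r * |((n:ℤ):ℝ)|))) := by
    have := Real.summable_exp_nat_mul_iff.2 (neg_lt_zero.2 hr)
    refine this.congr fun n => ?_
    simp; ring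
  rw [summable_int_iff_summable_nat_and_neg]
  refine ⟨h, h.congr fun n => ?_⟩
  simp

lemma SS_le_M (M : ℕ) (X : ℝ) : |SS M X| ≤ M := by
  unfold SS
  refine (Finset.abs_sum_le_sum_abs _ _).trans ?_
  calc _ ≤ ∑ n ∈ Finset.Icc 1 M, (1:ℝ) := by
        apply Finset.sum_le_sum
        intro n hn
        have : (1:ℝ) ≤ n := by exact_mod_cast (Finset.mem_Icc.1 hn).1
        rw [abs_div, abs_of_pos (by positivity : (0:ℝ) < n * π), div_le_one (by positivity)]
        refine (Real.abs_sin_le_one _).trans ?_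
        nlinarith [Real.pi_gt_three]
    _ = M := by simp

lemma sumsBound (d θ : ℝ) (hd : 0 < d) : ∃ C > 0, ∀ N : ℕ, 1 ≤ N → ∀ H : ℤ, ⌈d * Real.log N⌉ ≤ H →
    |∑ h ∈ Finset.Icc (1:ℤ) H, (IF (1/d) N (Real.exp (((h:ℝ)+θ)/d)) - IF (1/d) 0 (Real.exp (((h:ℝ)+θ)/d)))
     + ∑ h ∈ Finset.Ioo (0:ℤ) ⌈d * Real.log N⌉,
        SS ⌊d * N * Real.exp (-(((h:ℝ)+θ)/d))⌋₊ (Real.exp (((h:ℝ)+θ)/d))| ≤ C := by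
  obtain ⟨C, hC, hb⟩ := IF_bound (κ := 1/d) (c := Real.exp ((1+θ)/d)) (by positivity) (by positivity)
  set G1 := ∑' j : ℤ, Real.exp (-(1/(3*d) * |(j:ℝ)|)) with hG1
  set G2 := ∑' j : ℤ, Real.exp (-(1/d * |(j:ℝ)|)) with hG2
  have s1 := expabs_summable (r := 1/(3*d)) (by positivity)
  have s2 := expabs_summable (r := 1/d) (by positivity)
  have G10 : 0 ≤ G1 := tsum_nonneg fun n => by positivity
  have G20 : 0 ≤ G2 := tsum_nonneg fun n => by positivity
  refine ⟨C * (2 * Real.exp (-(θ/(3*d))) * G1 + 2 * G2) + d * Real.exp (-(θ/d)) * G2 + 1, by positivity,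
    fun N hN H hH => ?_⟩
  have hN0 : (0:ℝ) < N := by exact_mod_cast hN
  set L := ⌈d * Real.log N⌉ with hL
  set X : ℤ → ℝ := fun h => Real.exp (((h:ℝ)+θ)/d) with hXd
  set M : ℤ → ℝ := fun h => d * N * Real.exp (-(((h:ℝ)+θ)/d)) with hMd
  set η := d * Real.log (2 * d * N) - θ with hη
  have sub : ∑ h ∈ Finset.Ioo (0:ℤ) L, SS ⌊M h⌋₊ (X h) =
      ∑ h ∈ Finset.Icc (1:ℤ) H, if h < L then SS ⌊M h⌋₊ (X h) else 0 := by
    rw [← Finset.sum_filter]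
    apply Finset.sum_congr _ (fun _ _ => rfl)
    ext h
    simp only [Finset.mem_Ioo, Finset.mem_filter, Finset.mem_Icc]
    omega
  change |∑ h ∈ Finset.Icc (1:ℤ) H, (IF (1/d) N (X h) - IF (1/d) 0 (X h)) +
    ∑ h ∈ Finset.Ioo (0:ℤ) L, SS ⌊M h⌋₊ (X h)| ≤ _
  rw [sub, ← Finset.sum_add_distrib]
  refine (Finset.abs_sum_le_sum_abs _ _).trans ?_
  have term : ∀ h ∈ Finset.Icc (1:ℤ) H, |IF (1/d) N (X h) - IF (1/d) 0 (X h) +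
      if h < L then SS ⌊M h⌋₊ (X h) else 0| ≤
      C * (2 * Real.exp (-(θ/(3*d))) * Real.exp (-(1/(3*d) * |((h - 0 : ℤ):ℝ)|)) +
        2 * Real.exp (-(1/d * |((h - ⌊η⌋ : ℤ):ℝ)|))) +
        d * Real.exp (-(θ/d)) * Real.exp (-(1/d * |((h - L : ℤ):ℝ)|)) := by
    intro h hh
    have h1 : (1:ℝ) ≤ h := by exact_mod_cast (Finset.mem_Icc.1 hh).1
    have hX0 : 0 < X h := Real.exp_pos _
    have hcX : Real.exp ((1+θ)/d) ≤ X h := by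
      simp only [hXd]
      gcongr
    have hM : (N:ℝ) / (1/d * X h) = M h := by
      simp only [hXd, hMd]; rw [Real.exp_neg]; field_simp
    have b1 := hb N (X h) hcX
    have b2 := hb 0 (X h) hcX
    rw [hM] at b1
    have z : nu 0 = 0 := by unfold nu; norm_num
    have z2 : SS 0 (X h) = 0 := by simp [SS]
    simp only [Nat.cast_zero, zero_div, Nat.floor_zero, z, z2, add_zero] at b2
    have M0 : 0 ≤ M h := by simp only [hMd]; positivity
    have t1 : X h ^ (-(1/3):ℝ) = Real.exp (-(θ/(3*d))) * Real.exp (-(1/(3*d) * |((h - 0 : ℤ):ℝ)|)) := by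
      simp only [hXd]
      rw [← Real.exp_mul, ← Real.exp_add]
      congr 1
      rw [sub_zero, abs_of_pos (by linarith)]
      field_simp
      ring
    have t2 : nu (M h) ≤ 2 * Real.exp (-(1/d * |((h - ⌊η⌋ : ℤ):ℝ)|)) := by
      unfold nu
      split_ifs with hm
      · have eM : M h = 1/2 * Real.exp ((η - h)/d) := by
          simp only [hMd, hη]
          have : (d * Real.log (2 * d * N) - θ - h)/d = Real.log (2 * d * N) + -((h+θ)/d) := by
            field_simp; ring
          rw [this, Real.exp_add, Real.exp_log (by positivity)]; ring
        have hlt : (h:ℝ) < η := by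
          rw [eM] at hm
          have : 1 < Real.exp ((η - h)/d) := by linarith
          rw [Real.one_lt_exp_iff] at this
          have := (div_pos_iff_of_pos_right hd).1 this
          linarith
        have hfl : h ≤ ⌊η⌋ := Int.le_floor.2 hlt.le
        have hfl' : (h:ℝ) ≤ ⌊η⌋ := by exact_mod_cast hfl
        have e1 : 1 / M h = 2 * Real.exp (-((η - h)/d)) := by
          rw [eM, Real.exp_neg]; field_simp
        rw [e1]
        push_cast
        rw [abs_of_nonpos (by linarith)]
        have := Int.floor_le η
        have e2 : 1/d * -((h:ℝ) - ⌊η⌋) = (⌊η⌋ - h)/d := by ring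
        rw [e2]
        gcongr
      · positivity
    have t3 : |IF (1/d) N (X h) - IF (1/d) 0 (X h) + SS ⌊M h⌋₊ (X h)| ≤
       C * (2 * X h ^ (-(1/3):ℝ) + nu (M h)) := by
      rw [abs_le] at *
      constructor <;> linarith [b1.1, b1.2, b2.1, b2.2]
    have t4 : C * (2 * X h ^ (-(1/3):ℝ) + nu (M h)) ≤ C * (2 * Real.exp (-(θ/(3*d))) * Real.exp (-(1/(3*d) * |((h - 0 : ℤ):ℝ)|)) +
        2 * Real.exp (-(1/d * |((h - ⌊η⌋ : ℤ):ℝ)|))) := by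
      rw [t1, mul_assoc]
      gcongr
    have t5 : 0 ≤ d * Real.exp (-(θ/d)) * Real.exp (-(1/d * |((h - L : ℤ):ℝ)|)) := by positivity
    split_ifs with hl
    · linarith
    · push Not at hl
      have hl' : (L:ℝ) ≤ h := by exact_mod_cast hl
      have hLc : d * Real.log N ≤ L := Int.le_ceil _
      have t6 : |SS ⌊M h⌋₊ (X h)| ≤ d * Real.exp (-(θ/d)) * Real.exp (-(1/d * |((h - L : ℤ):ℝ)|)) := by
        refine (SS_le_M _ _).trans ((Nat.floor_le M0).trans ?_)
        push_cast
        rw [abs_of_nonneg (by linarith)]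
        have eM : M h = d * Real.exp (-(θ/d)) * Real.exp (-(1/d * (h - d * Real.log N))) := by
          simp only [hMd]
          rw [mul_assoc, mul_assoc]
          congr 1
          rw [← Real.exp_add]
          have : -(θ/d) + -(1/d * (h - d * Real.log N)) = Real.log N + -((h+θ)/d) := by
            field_simp; ring
          rw [this, Real.exp_add, Real.exp_log hN0]
        rw [eM]
        gcongr
      have e : IF (1/d) N (X h) - IF (1/d) 0 (X h) + 0 = (IF (1/d) N (X h) - IF (1/d) 0 (X h) + SS ⌊M h⌋₊ (X h)) - SS ⌊M h⌋₊ (X h) := by ring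
      rw [e]
      refine (abs_sub _ _).trans ?_
      linarith
  refine (Finset.sum_le_sum term).trans ?_
  rw [Finset.sum_add_distrib, ← Finset.mul_sum, ← Finset.mul_sum, Finset.sum_add_distrib, ← Finset.mul_sum, ← Finset.mul_sum]
  have c1 := sum_shift s1 (fun j => by positivity) 0 (Finset.Icc (1:ℤ) H)
  have c2 := sum_shift s2 (fun j => by positivity) ⌊η⌋ (Finset.Icc (1:ℤ) H)
  have c3 := sum_shift s2 (fun j => by positivity) L (Finset.Icc (1:ℤ) H)
  calc _ ≤ C * (2 * Real.exp (-(θ/(3*d))) * G1 + 2 * G2) + d * Real.exp (-(θ/d)) * G2 := by gcongr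
    _ ≤ _ := by linarith

end ZS

namespace ZS
open Real

noncomputable def ZK (s : ℂ) (K : ℝ) : ℂ :=
  ∑ k ∈ Finset.Icc 1 ⌊K⌋₊, (k:ℂ)^(-s) - (K:ℂ)^(1-s)/(1-s) + (sw K : ℂ) * (K:ℂ)^(-s)

lemma cpow_cont (r : ℂ) {a b : ℝ} (ha : 0 < a) (hab : a ≤ b) :
    ContinuousOn (fun t : ℝ => (t:ℂ)^r) (Set.uIcc a b) := by
  intro t ht
  rw [Set.uIcc_of_le hab] at ht
  have : 0 < t := lt_of_lt_of_le ha ht.1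
  exact (Complex.continuousAt_ofReal_cpow_const t r (Or.inr this.ne')).continuousWithinAt

lemma sw_meas : Measurable sw := by
  unfold sw; exact measurable_fract.sub_const _

lemma sw_abs (x : ℝ) : |sw x| ≤ 1/2 := by
  unfold sw
  rw [abs_le]; constructor <;> linarith [Int.fract_nonneg x, Int.fract_lt_one x]

lemma sw_cpow_int (r : ℂ) {a b : ℝ} (ha : 0 < a) (hab : a ≤ b) :
    IntervalIntegrable (fun t : ℝ => (sw t:ℂ) * (t:ℂ)^r) MeasureTheory.volume a b := by
  have h := (cpow_cont r ha hab).intervalIntegrable (μ := MeasureTheory.volume)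
  rw [intervalIntegrable_iff] at h ⊢
  refine MeasureTheory.Integrable.bdd_mul (c := 1/2) h ?_ ?_
  · exact (Complex.measurable_ofReal.comp sw_meas).aestronglyMeasurable
  · refine Filter.Eventually.of_forall fun x => ?_
    rw [Complex.norm_real]; exact sw_abs x

lemma floor_sw {t : ℝ} (ht : 0 ≤ t) : ((⌊t⌋₊:ℝ)) = t - sw t - 1/2 := by
  unfold sw
  have h1 : ((⌊t⌋₊:ℤ)) = ⌊t⌋ := Int.natCast_floor_eq_floor ht
  have h2 : ((⌊t⌋₊:ℝ)) = (⌊t⌋:ℝ) := by exact_mod_cast congrArg (fun z : ℤ => (z:ℝ)) h1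
  rw [h2]; have := Int.floor_add_fract t; linarith

lemma floor_swC {t : ℝ} (ht : 0 ≤ t) : ((⌊t⌋₊:ℂ)) = t - sw t - 1/2 := by
  have := congrArg (fun z : ℝ => (z:ℂ)) (floor_sw ht)
  push_cast at this; exact this

lemma ZK_step (s : ℂ) (hs0 : s ≠ 0) (hs1 : s ≠ 1) {a b : ℝ} (ha : 0 < a) (hab : a ≤ b) :
    ZK s b = ZK s a - s * ∫ t in a..b, (sw t:ℂ) * (t:ℂ)^(-s-1) := by
  have hder : ∀ t ∈ Set.Icc a b, HasDerivAt (fun y : ℝ => (y:ℂ)^(-s)) (-s * (t:ℂ)^(-s-1)) t := by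
    intro t ht
    exact hasDerivAt_ofReal_cpow_const (lt_of_lt_of_le ha ht.1).ne' (neg_ne_zero.2 hs0)
  have habel := sum_mul_eq_sub_sub_integral_mul (f := fun y : ℝ => (y:ℂ)^(-s)) (fun _ => (1:ℂ))
    ha.le hab (fun t ht => (hder t ht).differentiableAt) (by
      have : ContinuousOn (fun t : ℝ => -s * (t:ℂ)^(-s-1)) (Set.Icc a b) := by
        have := cpow_cont (-s-1) ha hab
        rw [Set.uIcc_of_le hab] at this
        exact continuousOn_const.mul this
      refine (this.congr fun t ht => (hder t ht).deriv).integrableOn_Icc)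
  rw [← intervalIntegral.integral_of_le hab] at habel
  have hI : (∫ t in a..b, deriv (fun y : ℝ => (y:ℂ)^(-s)) t * ∑ k ∈ Finset.Icc 0 ⌊t⌋₊, (1:ℂ))
     = ∫ t in a..b, ((s * ((sw t:ℂ) * (t:ℂ)^(-s-1))) - (s * (t:ℂ)^(-s) + (s/2) * (t:ℂ)^(-s-1))) := by
    apply intervalIntegral.integral_congr
    intro t ht
    rw [Set.uIcc_of_le hab] at ht
    have ht0 := lt_of_lt_of_le ha ht.1
    simp only
    rw [(hder t ht).deriv]
    simp only [Finset.sum_const, Nat.card_Icc, nsmul_eq_mul, mul_one]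
    push_cast
    rw [floor_swC ht0.le]
    have : (t:ℂ)^(-s) = (t:ℂ)^(-s-1) * t := by
      rw [Complex.cpow_sub _ _ (by exact_mod_cast ht0.ne'), Complex.cpow_one]
      have : (t:ℂ) ≠ 0 := by exact_mod_cast ht0.ne'
      field_simp
    rw [this]; ring
  have hF : (∫ t in a..b, (s * (t:ℂ)^(-s) + (s/2) * (t:ℂ)^(-s-1)))
      = (s * (b:ℂ)^(1-s) / (1-s) - (b:ℂ)^(-s)/2) - (s * (a:ℂ)^(1-s) / (1-s) - (a:ℂ)^(-s)/2) := by
    have h1s : (1 - s) ≠ 0 := sub_ne_zero.2 (Ne.symm hs1)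
    rw [intervalIntegral.integral_eq_sub_of_hasDerivAt
      (f := fun t : ℝ => s * (t:ℂ)^(1-s) / (1-s) - (t:ℂ)^(-s)/2)]
    · intro t ht
      rw [Set.uIcc_of_le hab] at ht
      have ht0 := lt_of_lt_of_le ha ht.1
      have h1 := hasDerivAt_ofReal_cpow_const ht0.ne' h1s
      refine (((h1.const_mul s).div_const (1-s)).sub ((hder t ht).div_const 2)).congr_deriv ?_
      rw [show (1 - s - 1) = -s by ring]
      field_simp
      ring
    · exact ((continuousOn_const.mul (cpow_cont _ ha hab)).add
        (continuousOn_const.mul (cpow_cont _ ha hab))).intervalIntegrable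
  have hci : IntervalIntegrable (fun t : ℝ => s * (t:ℂ)^(-s) + (s/2) * (t:ℂ)^(-s-1))
      MeasureTheory.volume a b := by
    exact ((continuousOn_const.mul (cpow_cont _ ha hab)).add
        (continuousOn_const.mul (cpow_cont _ ha hab))).intervalIntegrable
  rw [intervalIntegral.integral_sub ((sw_cpow_int _ ha hab).const_mul s) hci, hF,
    intervalIntegral.integral_const_mul] at hI
  rw [hI] at habel
  simp only [Finset.sum_const, Nat.card_Icc, nsmul_eq_mul, mul_one] at habel
  push_cast at habel
  rw [floor_swC ha.le, floor_swC (ha.le.trans hab)] at habel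
  have hsplit : ∑ k ∈ Finset.Icc 1 ⌊b⌋₊, (k:ℂ)^(-s) = ∑ k ∈ Finset.Icc 1 ⌊a⌋₊, (k:ℂ)^(-s)
      + ∑ k ∈ Finset.Ioc ⌊a⌋₊ ⌊b⌋₊, (k:ℂ)^(-s) := by
    have hle : ⌊a⌋₊ ≤ ⌊b⌋₊ := Nat.floor_le_floor hab
    have e1 : ∀ m : ℕ, Finset.Icc 1 m = Finset.Ioc 0 m := by intro m; ext; simp; omega
    rw [e1, e1, Finset.sum_Ioc_consecutive _ (Nat.zero_le _) hle]
  unfold ZK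
  rw [hsplit, habel]
  have h1s : (1 - s) ≠ 0 := sub_ne_zero.2 (Ne.symm hs1)
  have hpow : ∀ t : ℝ, 0 < t → (t:ℂ)^(1-s) = t * (t:ℂ)^(-s) := by
    intro t ht
    rw [show 1 - s = 1 + -s by ring, Complex.cpow_add _ _ (by exact_mod_cast ht.ne'), Complex.cpow_one]
  rw [hpow a ha, hpow b (ha.trans_le hab)]
  field_simp
  ring

noncomputable def Psi (x : ℝ) : ℝ := (Int.fract x ^ 2 - Int.fract x) / 2

lemma Psi_cont : Continuous Psi := by
  have : ContinuousOn (fun y : ℝ => (y^2 - y)/2) (Set.Icc 0 1) := by fun_prop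
  exact ContinuousOn.comp_fract'' this (by norm_num)

lemma Psi_abs (x : ℝ) : |Psi x| ≤ 1 := by
  unfold Psi
  have h1 := Int.fract_nonneg x
  have h2 := Int.fract_lt_one x
  rw [abs_le]; constructor <;> nlinarith

lemma Psi_deriv {x : ℝ} (hx : x ∉ Set.range (fun n : ℤ => (n:ℝ))) : HasDerivAt Psi (sw x) x := by
  have h1 : HasDerivAt (fun y : ℝ => ((y - ⌊x⌋)^2 - (y - ⌊x⌋))/2) (sw x) x := by
    have h0 : HasDerivAt (fun y : ℝ => y - ⌊x⌋) 1 x := (hasDerivAt_id x).sub_const _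
    refine (((h0.pow 2).sub h0).div_const 2).congr_deriv ?_
    unfold sw Int.fract
    push_cast; ring
  refine h1.congr_of_eventuallyEq ?_
  have hlt : (⌊x⌋:ℝ) < x := lt_of_le_of_ne (Int.floor_le x) (fun h => hx ⟨_, h⟩)
  filter_upwards [Ioo_mem_nhds hlt (Int.lt_floor_add_one x)] with y hy
  have : ⌊y⌋ = ⌊x⌋ := Int.floor_eq_iff.2 ⟨hy.1.le, hy.2⟩
  unfold Psi Int.fract
  rw [this]

lemma sw_parts (s : ℂ) (hs : -1 < s.re) {K : ℝ} (hK : 1 ≤ K) :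
    ∫ t in (1:ℝ)..K, (sw t:ℂ) * (t:ℂ)^(-s-1) =
      (Psi K : ℂ) * (K:ℂ)^(-s-1) + (s+1) * ∫ t in (1:ℝ)..K, (t:ℂ)^(-s-2) * (Psi t : ℂ) := by
  have hs1 : -s - 1 ≠ 0 := by
    intro h
    have := congrArg Complex.re h
    simp at this
    linarith
  have hPc : Continuous (fun t : ℝ => (Psi t : ℂ)) := Complex.continuous_ofReal.comp Psi_cont
  have hi2 : IntervalIntegrable (fun t : ℝ => (t:ℂ)^(-s-2) * (Psi t : ℂ)) MeasureTheory.volume 1 K :=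
    ((cpow_cont _ one_pos hK).mul hPc.continuousOn).intervalIntegrable
  have hi1 := sw_cpow_int (-s-1) one_pos hK
  have key := MeasureTheory.integral_eq_of_hasDerivAt_off_countable
    (fun t : ℝ => (Psi t : ℂ) * (t:ℂ)^(-s-1))
    (fun t : ℝ => (sw t:ℂ) * (t:ℂ)^(-s-1) - (s+1) * ((t:ℂ)^(-s-2) * (Psi t : ℂ)))
    (a := 1) (b := K) (Set.countable_range (fun n : ℤ => (n:ℝ)))
    (hPc.continuousOn.mul (cpow_cont _ one_pos hK)) (by
      intro x hx
      have h1x : 1 < x := by have := hx.1.1; rwa [min_eq_left hK] at this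
      have h1 := (Psi_deriv hx.2).ofReal_comp
      have h2 := hasDerivAt_ofReal_cpow_const (x := x) (by linarith) hs1
      refine (h1.mul h2).congr_deriv ?_
      rw [show -s - 1 - 1 = -s - 2 by ring]
      ring) (hi1.sub (hi2.const_mul _))
  rw [intervalIntegral.integral_sub hi1 (hi2.const_mul _), intervalIntegral.integral_const_mul] at key
  have : Psi 1 = 0 := by simp [Psi]
  rw [this] at key
  rw [sub_eq_iff_eq_add] at key
  rw [key]
  push_cast; ring

noncomputable def PsiI : ℝ → ℂ := Set.indicator (Set.Ioi (1:ℝ)) (fun t : ℝ => (Psi t : ℂ))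

lemma PsiI_loc : MeasureTheory.LocallyIntegrableOn PsiI (Set.Ioi 0) := by
  have hPc : Continuous (fun t : ℝ => (Psi t : ℂ)) := Complex.continuous_ofReal.comp Psi_cont
  have : MeasureTheory.LocallyIntegrable PsiI := hPc.locallyIntegrable.indicator measurableSet_Ioi
  exact this.locallyIntegrableOn _

lemma PsiI_top : PsiI =O[Filter.atTop] (fun x : ℝ => x ^ (-(0:ℝ))) := by
  refine Asymptotics.IsBigO.of_bound 1 (Filter.Eventually.of_forall fun x => ?_)
  simp only [neg_zero, Real.rpow_zero, norm_one, mul_one]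
  unfold PsiI
  refine (norm_indicator_le_norm_self _ _).trans ?_
  rw [Complex.norm_real]; exact Psi_abs x

lemma PsiI_bot (b : ℝ) : PsiI =O[nhdsWithin 0 (Set.Ioi 0)] (fun x : ℝ => x ^ (-b)) := by
  refine Asymptotics.IsBigO.of_bound 0 ?_
  have : Set.Iio (1:ℝ) ∈ nhdsWithin (0:ℝ) (Set.Ioi 0) :=
    mem_nhdsWithin_of_mem_nhds (Iio_mem_nhds one_pos)
  filter_upwards [this] with x hx
  unfold PsiI
  rw [Set.indicator_of_notMem (by simpa using (le_of_lt hx))]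
  simp

lemma B_conv (s : ℂ) (hs : -1 < s.re) : MellinConvergent PsiI (-s-1) := by
  refine mellinConvergent_of_isBigO_rpow (a := 0) (b := -s.re - 2) PsiI_loc PsiI_top ?_ (PsiI_bot _) ?_
  · simp; linarith
  · simp <;> linarith

lemma B_diff (s : ℂ) (hs : -1 < s.re) : DifferentiableAt ℂ (mellin PsiI) (-s-1) := by
  refine mellin_differentiableAt_of_isBigO_rpow (a := 0) (b := -s.re - 2) PsiI_loc PsiI_top ?_
    (PsiI_bot _) ?_
  · simp; linarith
  · simp <;> linarith

lemma PsiI_smul (s : ℂ) : (fun t : ℝ => (t:ℂ)^((-s-1)-1) • PsiI t) =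
    Set.indicator (Set.Ioi (1:ℝ)) (fun t : ℝ => (t:ℂ)^(-s-2) * (Psi t : ℂ)) := by
  funext t
  unfold PsiI
  rw [show -s - 1 - 1 = -s - 2 by ring]
  by_cases h : t ∈ Set.Ioi (1:ℝ)
  · rw [Set.indicator_of_mem h, Set.indicator_of_mem h, smul_eq_mul]
  · rw [Set.indicator_of_notMem h, Set.indicator_of_notMem h, smul_zero]

lemma B_tendsto (s : ℂ) (hs : -1 < s.re) :
    Filter.Tendsto (fun K : ℝ => ∫ t in (1:ℝ)..K, (t:ℂ)^(-s-2) * (Psi t : ℂ)) Filter.atTop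
      (nhds (mellin PsiI (-s-1))) := by
  have hc := B_conv s hs
  unfold MellinConvergent at hc
  rw [PsiI_smul] at hc
  have hsub : Set.Ioi (0:ℝ) ∩ Set.Ioi 1 = Set.Ioi 1 := by
    rw [Set.Ioi_inter_Ioi]; simp
  have hval : mellin PsiI (-s-1) = ∫ t in Set.Ioi (1:ℝ), (t:ℂ)^(-s-2) * (Psi t : ℂ) := by
    unfold mellin
    rw [PsiI_smul, MeasureTheory.setIntegral_indicator measurableSet_Ioi, hsub]
  rw [hval]
  refine MeasureTheory.intervalIntegral_tendsto_integral_Ioi _ ?_ Filter.tendsto_id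
  have h2 := hc.mono_set (Set.Ioi_subset_Ioi (zero_le_one (α := ℝ)))
  exact h2.congr_fun (fun t ht => Set.indicator_of_mem ht _) measurableSet_Ioi

lemma cpow_tendsto_zero (r : ℂ) (hr : r.re < 0) (g : ℝ → ℂ) (hg : ∀ x, ‖g x‖ ≤ 1) :
    Filter.Tendsto (fun K : ℝ => g K * (K:ℂ)^r) Filter.atTop (nhds 0) := by
  rw [tendsto_zero_iff_norm_tendsto_zero]
  have h := tendsto_rpow_neg_atTop (y := -r.re) (by linarith)
  rw [neg_neg] at h
  refine squeeze_zero' (Filter.Eventually.of_forall fun _ => norm_nonneg _) ?_ h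
  filter_upwards [Filter.eventually_gt_atTop 0] with K hK
  rw [norm_mul, Complex.norm_cpow_eq_rpow_re_of_pos hK]
  have := Real.rpow_nonneg hK.le r.re
  nlinarith [hg K]

noncomputable def GG (s : ℂ) : ℂ := 1/2 - 1/(1-s) - s * ((s+1) * mellin PsiI (-s-1))

lemma ZK_tendsto_GG (s : ℂ) (hs : -1 < s.re) (hs0 : s ≠ 0) (hs1 : s ≠ 1) :
    Filter.Tendsto (ZK s) Filter.atTop (nhds (GG s)) := by
  have h1 : Filter.Tendsto (fun K : ℝ => 1/2 - 1/(1-s) - s * ((Psi K : ℂ) * (K:ℂ)^(-s-1) +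
      (s+1) * ∫ t in (1:ℝ)..K, (t:ℂ)^(-s-2) * (Psi t : ℂ))) Filter.atTop
      (nhds (1/2 - 1/(1-s) - s * (0 + (s+1) * mellin PsiI (-s-1)))) := by
    refine tendsto_const_nhds.sub (Filter.Tendsto.const_mul _ (Filter.Tendsto.add ?_
      ((B_tendsto s hs).const_mul _)))
    refine cpow_tendsto_zero _ (by simp; linarith) (fun x => (Psi x : ℂ)) fun x => ?_
    rw [Complex.norm_real]; exact Psi_abs x
  rw [zero_add] at h1
  refine h1.congr' ?_
  filter_upwards [Filter.eventually_ge_atTop 1] with K hK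
  rw [ZK_step s hs0 hs1 one_pos hK, sw_parts s hs hK]
  congr 1
  simp [ZK, sw]
  ring

lemma ZK_tendsto_zeta (s : ℂ) (hs : 1 < s.re) :
    Filter.Tendsto (fun n : ℕ => ZK s n) Filter.atTop (nhds (riemannZeta s)) := by
  have hs0 : s ≠ 0 := by rintro rfl; simp at hs; linarith
  have h1 : Filter.Tendsto (fun n : ℕ => ∑ k ∈ Finset.Icc 1 n, (k:ℂ)^(-s)) Filter.atTop
      (nhds (riemannZeta s)) := by
    have h := ((Complex.summable_one_div_nat_cpow.2 hs).hasSum.tendsto_sum_nat)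
    rw [← zeta_eq_tsum_one_div_nat_cpow hs] at h
    refine (h.comp (Filter.tendsto_add_atTop_nat 1)).congr fun n => ?_
    simp only [Function.comp]
    rw [Finset.sum_range_eq_add_Ico _ (by omega)]
    simp only [Nat.cast_zero, Complex.zero_cpow hs0, div_zero, zero_add]
    apply Finset.sum_congr
    · ext; simp <;> omega
    · intro k _; rw [Complex.cpow_neg, one_div]
  have h2 : Filter.Tendsto (fun n : ℕ => (1 * (((n:ℕ):ℝ):ℂ)^(1-s))/(1-s)) Filter.atTop (nhds (0/(1-s))) := by
    have := (cpow_tendsto_zero (1-s) (by simp; linarith) (fun _ => 1) (fun _ => by simp)).comp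
      (tendsto_natCast_atTop_atTop (R := ℝ))
    exact this.div_const _
  have h3 : Filter.Tendsto (fun n : ℕ => (sw (n:ℝ) : ℂ) * (((n:ℕ):ℝ):ℂ)^(-s)) Filter.atTop (nhds 0) := by
    exact (cpow_tendsto_zero (-s) (by simp; linarith) (fun x => (sw x : ℂ)) (fun x => by
      rw [Complex.norm_real]; exact (sw_abs x).trans (by norm_num))).comp
      tendsto_natCast_atTop_atTop
  have := (h1.sub h2).add h3
  rw [zero_div, sub_zero, add_zero] at this
  refine this.congr fun n => ?_
  unfold ZK
  rw [Nat.floor_natCast, one_mul]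

lemma GG_eq_zeta (s : ℂ) (hs : -1 < s.re) (hs1 : s ≠ 1) : GG s = riemannZeta s := by
  let F : ℂ → ℂ := fun s => (s-1)/2 + 1 - (s-1) * (s * ((s+1) * mellin PsiI (-s-1)))
  let U : Set ℂ := {s | -1 < s.re}
  have hU : IsOpen U := isOpen_lt continuous_const Complex.continuous_re
  have hFd : DifferentiableOn ℂ F U := by
    intro z hz
    have h1 : DifferentiableAt ℂ (fun z : ℂ => mellin PsiI (-z-1)) z :=
      DifferentiableAt.comp (g := mellin PsiI) (f := fun z : ℂ => -z-1) z (B_diff z hz) (by fun_prop)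
    refine DifferentiableAt.differentiableWithinAt ?_
    fun_prop
  have hFG : ∀ z : ℂ, z ≠ 1 → F z = (z-1) * GG z := by
    intro z hz
    have : 1 - z ≠ 0 := sub_ne_zero.2 (Ne.symm hz)
    simp only [F, GG]
    field_simp
    ring
  have hpre : IsPreconnected U := (convex_halfSpace_re_gt (-1)).isPreconnected
  have heq := AnalyticOnNhd.eqOn_of_preconnected_of_eventuallyEq (hFd.analyticOnNhd hU)
    (differentiable_riemannZeta₁.differentiableOn.analyticOnNhd hU) hpre (z₀ := 2)
    (by simp [U]; norm_num) (by
      have hV : {z : ℂ | 1 < z.re} ∈ nhds (2:ℂ) :=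
        (isOpen_lt continuous_const Complex.continuous_re).mem_nhds (by simp)
      filter_upwards [hV] with z hz
      have hz' : 1 < z.re := hz
      have hz1 : z ≠ 1 := by rintro rfl; simp at hz'
      have hz0 : z ≠ 0 := by rintro rfl; simp at hz'; linarith
      have e1 := tendsto_nhds_unique ((ZK_tendsto_GG z (by linarith) hz0 hz1).comp
        (tendsto_natCast_atTop_atTop (R := ℝ))) (ZK_tendsto_zeta z hz')
      rw [hFG z hz1, e1, riemannZeta_eq_inv_sub_mul hz1]
      have := sub_ne_zero.2 hz1
      field_simp)
  have h := heq (show s ∈ U from hs)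
  rw [hFG s hs1] at h
  rw [riemannZeta_eq_inv_sub_mul hs1, ← h]
  have := sub_ne_zero.2 hs1
  field_simp

lemma ZK_lim (s : ℂ) (hs : -1 < s.re) (hs0 : s ≠ 0) (hs1 : s ≠ 1) :
    Filter.Tendsto (ZK s) Filter.atTop (nhds (riemannZeta s)) := by
  rw [← GG_eq_zeta s hs hs1]; exact ZK_tendsto_GG s hs hs0 hs1

end ZS

namespace ZS
open Real

noncomputable def EE (N : ℕ) : Finset ℤ := (Finset.Icc (-(N : ℤ)) (N : ℤ)).erase 0

lemma EE_ne {N : ℕ} {n : ℤ} (h : n ∈ EE N) : n ≠ 0 := Finset.ne_of_mem_erase h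

lemma EE_sum (f : ℤ → ℂ) (N : ℕ) :
    ∑ n ∈ EE N, f n = ∑ n ∈ Finset.Icc 1 N, (f (n:ℤ) + f (-(n:ℤ))) := by
  induction N with
  | zero => simp [EE]
  | succ k ih =>
    have h : EE (k+1) = insert ((k+1 : ℕ):ℤ) (insert (-((k+1 : ℕ):ℤ)) (EE k)) := by
      ext z; simp [EE]; omega
    rw [h, Finset.sum_insert, Finset.sum_insert, ih, Finset.sum_Icc_succ_top (by omega)]
    · ring
    · simp [EE]
    · simp [EE]; omega

noncomputable def ex (n : ℤ) (y : ℝ) : ℂ := Complex.exp (2 * (π:ℂ) * Complex.I * (y:ℂ) * (n:ℂ))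

lemma ex_pos (n : ℕ) (y : ℝ) : ex (n:ℤ) y = Complex.cos ((2 * π * n * y : ℝ)) +
    Complex.sin ((2 * π * n * y : ℝ)) * Complex.I := by
  rw [← Complex.exp_mul_I]; unfold ex; congr 1; push_cast; ring

lemma ex_neg (n : ℕ) (y : ℝ) : ex (-(n:ℤ)) y = Complex.cos ((2 * π * n * y : ℝ)) -
    Complex.sin ((2 * π * n * y : ℝ)) * Complex.I := by
  have : ex (-(n:ℤ)) y = Complex.exp ((-((2 * π * n * y : ℝ):ℂ)) * Complex.I) := by
    unfold ex; congr 1; push_cast; ring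
  rw [this, Complex.exp_mul_I, Complex.cos_neg, Complex.sin_neg]; ring

lemma ex_norm (n : ℤ) (y : ℝ) : ‖ex n y‖ = 1 := by
  unfold ex
  rw [show 2 * (π:ℂ) * Complex.I * (y:ℂ) * (n:ℂ) = ((2 * π * y * n : ℝ):ℂ) * Complex.I by push_cast; ring]
  exact Complex.norm_exp_ofReal_mul_I _

lemma DK_pair (N : ℕ) (y : ℝ) : ∑ n ∈ EE N, ex n y = ((DK N y - 1 : ℝ) : ℂ) := by
  rw [EE_sum]
  unfold DK
  rw [add_sub_cancel_left, Finset.mul_sum]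
  push_cast
  apply Finset.sum_congr rfl
  intro n _
  rw [ex_pos, ex_neg]; push_cast; ring

lemma SS_pair (N : ℕ) (y : ℝ) :
    (1 / (2 * (π:ℂ) * Complex.I)) * ∑ n ∈ EE N, ex n y / (n:ℂ) = (SS N y : ℂ) := by
  rw [EE_sum, Finset.mul_sum]
  unfold SS
  push_cast
  apply Finset.sum_congr rfl
  intro n hn
  have hn0 : (n:ℂ) ≠ 0 := by
    have := (Finset.mem_Icc.1 hn).1
    exact_mod_cast (by omega : n ≠ 0)
  have hp : (π:ℂ) ≠ 0 := by exact_mod_cast Real.pi_ne_zero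
  rw [ex_pos, ex_neg]; push_cast
  field_simp
  ring

noncomputable def sn (d : ℝ) (n : ℤ) : ℂ := 2 * (π:ℂ) * Complex.I * (d:ℂ) * (n:ℂ)

lemma sn_eq (d : ℝ) (n : ℤ) : sn d n = ((2 * π * d * n : ℝ) : ℂ) * Complex.I := by
  unfold sn; push_cast; ring

lemma sn_re (d : ℝ) (n : ℤ) : (sn d n).re = 0 := by rw [sn_eq]; simp
lemma sn_im (d : ℝ) (n : ℤ) : (sn d n).im = 2 * π * d * n := by rw [sn_eq]; simp

lemma sn_ne0 {d : ℝ} (hd : 0 < d) {n : ℤ} (hn : n ≠ 0) : sn d n ≠ 0 := by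
  intro h
  have := congrArg Complex.im h
  rw [sn_im] at this
  simp [hd.ne', hn, Real.pi_ne_zero] at this

lemma sn_ne1 {d : ℝ} (n : ℤ) : sn d n ≠ 1 := by
  intro h
  have := congrArg Complex.re h
  rw [sn_re] at this
  simp at this

lemma ecpow (d θ : ℝ) (n : ℤ) {t : ℝ} (ht : 0 < t) :
    (t:ℂ)^(-(sn d n)) * ex n θ = ex n (θ - d * Real.log t) := by
  rw [Complex.cpow_def_of_ne_zero (by exact_mod_cast ht.ne'), ← Complex.ofReal_log ht.le]
  unfold ex sn
  rw [← Complex.exp_add]; congr 1; push_cast; ring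

lemma P_bound (d θ x : ℝ) (hd : 0 < d) (hx : 0 < x) : ∃ C : ℝ, ∀ N : ℕ,
    ‖(1 / (2 * (π:ℂ) * Complex.I)) * ∑ n ∈ EE N, ZK (sn d n) x * ex n θ / (n:ℂ)‖ ≤ C := by
  have hsum : Summable (fun n : ℤ => 1 / (n:ℝ)^2) := Real.summable_one_div_int_pow.2 (by norm_num)
  refine ⟨2 * ⌊x⌋₊ + x / (2*π) * (1/(2*π*d)) * (∑' n : ℤ, 1 / (n:ℝ)^2) + 1, fun N => ?_⟩
  have hdec : (1 / (2 * (π:ℂ) * Complex.I)) * ∑ n ∈ EE N, ZK (sn d n) x * ex n θ / (n:ℂ) =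
      ∑ k ∈ Finset.Icc 1 ⌊x⌋₊, (SS N (θ - d * Real.log k) : ℂ)
      - (1 / (2 * (π:ℂ) * Complex.I)) * ∑ n ∈ EE N, (x:ℂ)^(1 - sn d n)/(1 - sn d n) * ex n θ / (n:ℂ)
      + sw x * (SS N (θ - d * Real.log x) : ℂ) := by
    have e1 : ∑ k ∈ Finset.Icc 1 ⌊x⌋₊, (SS N (θ - d * Real.log k) : ℂ) =
      (1 / (2 * (π:ℂ) * Complex.I)) * ∑ n ∈ EE N,
        (∑ k ∈ Finset.Icc 1 ⌊x⌋₊, (k:ℂ)^(-(sn d n))) * ex n θ / (n:ℂ) := by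
      simp_rw [← SS_pair, Finset.sum_mul, Finset.sum_div]
      rw [← Finset.mul_sum, Finset.sum_comm]
      congr 1
      apply Finset.sum_congr rfl
      intro n _
      apply Finset.sum_congr rfl
      intro k hk
      have hk0 : (0:ℝ) < k := by
        have := (Finset.mem_Icc.1 hk).1
        exact_mod_cast (by omega : 0 < k)
      rw [← ecpow d θ n hk0, Complex.ofReal_natCast]
    rw [e1, ← SS_pair, mul_left_comm (sw x : ℂ), Finset.mul_sum (EE N) _ (sw x : ℂ), ← mul_sub, ← mul_add, ← Finset.sum_sub_distrib,
      ← Finset.sum_add_distrib]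
    congr 1
    apply Finset.sum_congr rfl
    intro n _
    rw [← ecpow d θ n hx]
    unfold ZK
    ring
  rw [hdec]
  refine (norm_add_le _ _).trans (add_le_add ((norm_sub_le _ _).trans (add_le_add ?_ ?_)) ?_)
  · refine (norm_sum_le _ _).trans ?_
    refine (Finset.sum_le_sum (g := fun _ => (2:ℝ)) fun k _ => ?_).trans ?_
    · rw [Complex.norm_real]; exact SS_le _ _
    · simp; linarith
  · rw [norm_mul]
    have hc : ‖(1 / (2 * (π:ℂ) * Complex.I))‖ = 1/(2*π) := by
      simp [abs_of_pos Real.pi_pos]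
    rw [hc]
    have : ‖∑ n ∈ EE N, (x:ℂ)^(1 - sn d n)/(1 - sn d n) * ex n θ / (n:ℂ)‖ ≤
        x * (1/(2*π*d)) * ∑' n : ℤ, 1 / (n:ℝ)^2 := by
      refine (norm_sum_le _ _).trans ?_
      refine le_trans ?_ (mul_le_mul_of_nonneg_left (hsum.sum_le_tsum (EE N) (fun n _ => by positivity))
        (by positivity))
      rw [Finset.mul_sum]
      refine Finset.sum_le_sum fun n hn => ?_
      have hn0 := EE_ne hn
      have hna : 0 < |(n:ℝ)| := abs_pos.2 (by exact_mod_cast hn0)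
      rw [norm_div, norm_mul, norm_div, ex_norm, mul_one,
        Complex.norm_cpow_eq_rpow_re_of_pos hx, Complex.sub_re, sn_re, Complex.one_re, sub_zero,
        Real.rpow_one, Complex.norm_intCast]
      have h1 : 2*π*d*|(n:ℝ)| ≤ ‖1 - sn d n‖ := by
        have := Complex.abs_im_le_norm (1 - sn d n)
        rw [Complex.sub_im, sn_im, Complex.one_im, zero_sub, abs_neg, abs_mul,
          abs_of_pos (by positivity)] at this
        exact this
      have h2 : 0 < 2*π*d*|(n:ℝ)| := by positivity
      have h3 : x / ‖1 - sn d n‖ ≤ x / (2*π*d*|(n:ℝ)|) := div_le_div_of_nonneg_left hx.le h2 h1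
      refine (div_le_div_of_nonneg_right h3 hna.le).trans (le_of_eq ?_)
      rw [← sq_abs (n:ℝ)]
      field_simp
    calc 1/(2*π) * _ ≤ 1/(2*π) * _ := mul_le_mul_of_nonneg_left this (by positivity)
      _ = _ := by ring
  · rw [norm_mul, Complex.norm_real, Complex.norm_real]
    have h1 := sw_abs x
    have h2 := SS_le N (θ - d * Real.log x)
    calc |sw x| * |SS N (θ - d * Real.log x)| ≤ (1/2) * 2 := mul_le_mul h1 h2 (abs_nonneg _) (by norm_num)
      _ = 1 := by norm_num

noncomputable def KK (d θ : ℝ) (m : ℕ) : ℝ := Real.exp (((m:ℝ) + 1/2 + θ)/d)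

lemma DKsw_int (d θ : ℝ) (N : ℕ) {a b : ℝ} (ha : 0 < a) (hab : a ≤ b) :
    IntervalIntegrable (fun t : ℝ => sw t * ((DK N (θ - d * Real.log t) - 1) / t))
      MeasureTheory.volume a b := by
  have hc : ContinuousOn (fun t : ℝ => (DK N (θ - d * Real.log t) - 1) / t) (Set.uIcc a b) := by
    rw [Set.uIcc_of_le hab]
    have h0 : ∀ t ∈ Set.Icc a b, t ≠ 0 := fun t ht => (lt_of_lt_of_le ha ht.1).ne'
    refine ContinuousOn.div (ContinuousOn.sub ?_ continuousOn_const) continuousOn_id h0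
    refine (DK_cont N).comp_continuousOn ?_
    exact continuousOn_const.sub (continuousOn_const.mul (Real.continuousOn_log.mono h0))
  have h := hc.intervalIntegrable (μ := MeasureTheory.volume)
  rw [intervalIntegrable_iff] at h ⊢
  refine MeasureTheory.Integrable.bdd_mul (c := 1/2) h ?_ ?_
  · exact sw_meas.aestronglyMeasurable
  · exact Filter.Eventually.of_forall fun x => sw_abs x

lemma IF_piece (d θ : ℝ) (hd : 0 < d) (N m : ℕ) :
    d * ∫ t in KK d θ m..KK d θ (m+1), sw t * ((DK N (θ - d * Real.log t) - 1) / t) =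
    IF (1/d) N (Real.exp ((((m+1:ℕ):ℝ) + θ)/d)) - IF (1/d) 0 (Real.exp ((((m+1:ℕ):ℝ) + θ)/d)) := by
  have hle : KK d θ m ≤ KK d θ (m+1) := by
    unfold KK
    apply Real.exp_le_exp.2
    apply div_le_div_of_nonneg_right _ hd.le
    push_cast; linarith
  set X := Real.exp ((((m+1:ℕ):ℝ) + θ)/d) with hX
  let f : ℝ → ℝ := fun u => X * Real.exp (1/d * u)
  have hfexp : ∀ u, f u = Real.exp ((((m+1:ℕ):ℝ) + θ + u)/d) := by
    intro u; simp only [f, hX]; rw [← Real.exp_add]; congr 1; ring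
  have hmono : StrictMono f := by
    intro u v huv
    rw [hfexp, hfexp]
    apply Real.exp_lt_exp.2
    apply div_lt_div_of_pos_right _ hd
    linarith
  have hf1 : f (-(1/2)) = KK d θ m := by
    rw [hfexp]; unfold KK; congr 1; push_cast; ring
  have hf2 : f (1/2) = KK d θ (m+1) := by
    rw [hfexp]; unfold KK; congr 1; push_cast; ring
  have himg : f '' (Set.Ioc (-(1/2)) (1/2)) = Set.Ioc (KK d θ m) (KK d θ (m+1)) := by
    ext t
    constructor
    · rintro ⟨u, hu, rfl⟩
      rw [← hf1, ← hf2]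
      exact ⟨hmono hu.1, hmono.monotone hu.2⟩
    · intro ht
      have ht0 : 0 < t := lt_trans (Real.exp_pos _) ht.1
      have hft : f (d * Real.log t - ((m+1:ℕ):ℝ) - θ) = t := by
        rw [hfexp, show (((m+1:ℕ):ℝ) + θ + (d * Real.log t - ((m+1:ℕ):ℝ) - θ))/d = Real.log t by
          field_simp; ring, Real.exp_log ht0]
      refine ⟨_, ?_, hft⟩
      rw [← hf1, ← hf2] at ht
      rw [← hft] at ht
      exact ⟨hmono.lt_iff_lt.1 ht.1, hmono.le_iff_le.1 ht.2⟩
  have hder : ∀ u ∈ Set.Ioc (-(1/2):ℝ) (1/2), HasDerivWithinAt f (f u / d) (Set.Ioc (-(1/2)) (1/2)) u := by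
    intro u _
    have h1 : HasDerivAt (fun u : ℝ => 1/d * u) (1/d) u := by
      simpa using (hasDerivAt_id u).const_mul (1/d)
    refine HasDerivAt.hasDerivWithinAt ((h1.exp.const_mul X).congr_deriv ?_)
    simp only [f]; ring
  have hcv := MeasureTheory.integral_image_eq_integral_abs_deriv_smul measurableSet_Ioc hder
    hmono.injective.injOn (fun t : ℝ => sw t * ((DK N (θ - d * Real.log t) - 1) / t))
  rw [himg, ← intervalIntegral.integral_of_le hle] at hcv
  rw [hcv, ← intervalIntegral.integral_of_le (by norm_num), ← intervalIntegral.integral_const_mul]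
  have hint : ∀ M : ℕ, IntervalIntegrable (fun u : ℝ => sw (X * Real.exp (1/d*u)) * DK M u)
      MeasureTheory.volume (-(1/2)) (1/2) := by
    intro M
    have h := (DK_cont M).intervalIntegrable (μ := MeasureTheory.volume) (-(1/2)) (1/2)
    rw [intervalIntegrable_iff] at h ⊢
    refine MeasureTheory.Integrable.bdd_mul (c := 1/2) h ?_ ?_
    · exact (sw_meas.comp (by fun_prop)).aestronglyMeasurable
    · exact Filter.Eventually.of_forall fun x => sw_abs _
  unfold IF
  rw [← intervalIntegral.integral_sub (hint N) (hint 0)]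
  apply intervalIntegral.integral_congr
  intro u _
  have hfp : 0 < f u := by rw [hfexp]; exact Real.exp_pos _
  have hD : DK N (θ - d * Real.log (f u)) = DK N u := by
    rw [hfexp, Real.log_exp, ← DK_even N u, ← DK_add_int N (-u) (-((m+1:ℕ):ℤ))]
    congr 1
    push_cast
    field_simp
    ring
  have hD0 : DK 0 u = 1 := by simp [DK]
  simp only [smul_eq_mul]
  rw [hD, hD0, abs_of_pos (by positivity)]
  change d * (f u / d * (sw (f u) * ((DK N u - 1) / f u))) = sw (f u) * DK N u - sw (f u) * 1
  field_simp

lemma KK_mono (d θ : ℝ) (hd : 0 < d) : Monotone (KK d θ) := by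
  intro a b hab
  unfold KK
  apply Real.exp_le_exp.2
  apply div_le_div_of_nonneg_right _ hd.le
  have : (a:ℝ) ≤ b := by exact_mod_cast hab
  linarith

lemma KK_tendsto (d θ : ℝ) (hd : 0 < d) : Filter.Tendsto (KK d θ) Filter.atTop Filter.atTop := by
  unfold KK
  refine Real.tendsto_exp_atTop.comp (Filter.Tendsto.atTop_div_const hd ?_)
  exact Filter.tendsto_atTop_add_const_right _ _
    (Filter.tendsto_atTop_add_const_right _ _ tendsto_natCast_atTop_atTop)

lemma IF_sum (d θ : ℝ) (hd : 0 < d) (N H : ℕ) :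
    d * ∫ t in KK d θ 0..KK d θ H, sw t * ((DK N (θ - d * Real.log t) - 1) / t) =
    ∑ h ∈ Finset.Icc (1:ℤ) (H:ℤ), (IF (1/d) N (Real.exp (((h:ℝ)+θ)/d)) - IF (1/d) 0 (Real.exp (((h:ℝ)+θ)/d))) := by
  induction H with
  | zero => simp
  | succ k ih =>
    have h : Finset.Icc (1:ℤ) ((k+1:ℕ):ℤ) = insert ((k+1:ℕ):ℤ) (Finset.Icc (1:ℤ) (k:ℤ)) := by
      ext z; simp; omega
    rw [h, Finset.sum_insert (by simp), ← ih,
      ← intervalIntegral.integral_add_adjacent_intervals (a := KK d θ 0) (b := KK d θ k) (c := KK d θ (k+1))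
        (DKsw_int d θ N (Real.exp_pos _) (KK_mono d θ hd (Nat.zero_le k)))
        (DKsw_int d θ N (Real.exp_pos _) (KK_mono d θ hd (Nat.le_succ k))), mul_add, IF_piece d θ hd]
    push_cast
    ring

lemma A_decomp (d θ : ℝ) (hd : 0 < d) (N H : ℕ) :
    (1 / (2 * (π:ℂ) * Complex.I)) * ∑ n ∈ EE N, ZK (sn d n) (KK d θ H) * ex n θ / (n:ℂ) =
    (1 / (2 * (π:ℂ) * Complex.I)) * ∑ n ∈ EE N, ZK (sn d n) (KK d θ 0) * ex n θ / (n:ℂ)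
    - ((∑ h ∈ Finset.Icc (1:ℤ) (H:ℤ), (IF (1/d) N (Real.exp (((h:ℝ)+θ)/d)) - IF (1/d) 0 (Real.exp (((h:ℝ)+θ)/d))) : ℝ) : ℂ) := by
  have hle := KK_mono d θ hd (Nat.zero_le H)
  have h0 : 0 < KK d θ 0 := Real.exp_pos _
  rw [← IF_sum d θ hd N H]
  have hI : ((∫ t in KK d θ 0..KK d θ H, sw t * ((DK N (θ - d * Real.log t) - 1) / t) : ℝ) : ℂ) =
      ∑ n ∈ EE N, (∫ t in KK d θ 0..KK d θ H, (sw t:ℂ) * (t:ℂ)^(-(sn d n)-1)) * ex n θ := by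
    simp_rw [← intervalIntegral.integral_mul_const]
    rw [← intervalIntegral.integral_finsetSum (fun n _ => (sw_cpow_int _ h0 hle).mul_const _),
      ← intervalIntegral.integral_ofReal]
    apply intervalIntegral.integral_congr
    intro t ht
    rw [Set.uIcc_of_le hle] at ht
    have ht0 : 0 < t := lt_of_lt_of_le h0 ht.1
    have htc : (t:ℂ) ≠ 0 := by exact_mod_cast ht0.ne'
    simp only
    rw [Complex.ofReal_mul, Complex.ofReal_div, ← DK_pair, Finset.sum_div, Finset.mul_sum]
    apply Finset.sum_congr rfl
    intro n _
    rw [← ecpow d θ n ht0, Complex.cpow_sub _ _ htc, Complex.cpow_one]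
    ring
  rw [Complex.ofReal_mul, hI, Finset.mul_sum, Finset.mul_sum, Finset.mul_sum, ← Finset.sum_sub_distrib]
  apply Finset.sum_congr rfl
  intro n hn
  have hn0 := EE_ne hn
  have hnc : (n:ℂ) ≠ 0 := by exact_mod_cast hn0
  have hp : (π:ℂ) ≠ 0 := by exact_mod_cast Real.pi_ne_zero
  rw [ZK_step (sn d n) (sn_ne0 hd hn0) (sn_ne1 n) h0 hle]
  have hs : (1 / (2 * (π:ℂ) * Complex.I)) * (sn d n) / n = d := by
    unfold sn
    field_simp
  rw [← hs]
  ring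

lemma main_bound (d θ : ℝ) (hd : 0 < d) : ∃ C > 0, ∀ N : ℕ, 1 ≤ N →
    ‖(1 / (2 * (π:ℂ) * Complex.I)) * ∑ n ∈ EE N, riemannZeta (sn d n) * ex n θ / (n:ℂ)
      - ((∑ h ∈ Finset.Ioo (0:ℤ) ⌈d*Real.log N⌉,
          SS ⌊d*N*Real.exp (-(((h:ℝ)+θ)/d))⌋₊ (Real.exp (((h:ℝ)+θ)/d)) : ℝ) : ℂ)‖ ≤ C := by
  obtain ⟨C1, hC1⟩ := P_bound d θ (KK d θ 0) hd (Real.exp_pos _)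
  obtain ⟨C2, hC2, h2⟩ := sumsBound d θ hd
  have hC10 : 0 ≤ C1 := (norm_nonneg _).trans (hC1 0)
  refine ⟨C1 + C2, by linarith, fun N hN => ?_⟩
  have hlim : Filter.Tendsto (fun H : ℕ =>
      (1 / (2 * (π:ℂ) * Complex.I)) * ∑ n ∈ EE N, ZK (sn d n) (KK d θ H) * ex n θ / (n:ℂ)) Filter.atTop
      (nhds ((1 / (2 * (π:ℂ) * Complex.I)) * ∑ n ∈ EE N, riemannZeta (sn d n) * ex n θ / (n:ℂ))) := by
    refine Filter.Tendsto.const_mul _ (tendsto_finsetSum _ fun n hn => ?_)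
    refine Filter.Tendsto.div_const (Filter.Tendsto.mul_const _ ?_) _
    exact (ZK_lim (sn d n) (by rw [sn_re]; norm_num) (sn_ne0 hd (EE_ne hn)) (sn_ne1 n)).comp
      (KK_tendsto d θ hd)
  refine le_of_tendsto (hlim.sub_const _).norm ?_
  filter_upwards [Filter.eventually_ge_atTop (⌈d*Real.log N⌉).toNat] with H hH
  have hH' : ⌈d*Real.log N⌉ ≤ (H:ℤ) := by omega
  rw [A_decomp d θ hd, sub_sub, ← Complex.ofReal_add]
  refine (norm_sub_le _ _).trans (add_le_add (hC1 N) ?_)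
  rw [Complex.norm_real]
  exact h2 N hN H hH'

end ZS

theorem statement2 (d θ : ℝ) (hd : 0 < d) :
    ∃ C > (0 : ℝ), ∃ N₀ : ℕ, ∀ N : ℕ, N₀ ≤ N → 2 ≤ N →
      ‖(1 / (2 * (Real.pi : ℂ) * Complex.I)) *
            (∑ n ∈ (Finset.Icc (-(N : ℤ)) (N : ℤ)).erase 0,
              riemannZeta (2 * (Real.pi : ℂ) * Complex.I * (d : ℂ) * (n : ℂ)) *
                Complex.exp (2 * (Real.pi : ℂ) * Complex.I * (θ : ℂ) * (n : ℂ)) / (n : ℂ))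
          - ((∑ h ∈ Finset.Ioo (0 : ℤ) ⌈d * Real.log N⌉,
                ∑ n ∈ Finset.Icc 1 ⌊d * N * Real.exp (-(((h : ℝ) + θ) / d))⌋₊,
                  Real.sin (2 * Real.pi * n * Real.exp (((h : ℝ) + θ) / d)) /
                    (n * Real.pi) : ℝ) : ℂ)‖
        ≤ C * (Real.log N) ^ ((2 : ℝ) / 3) * (Real.log (Real.log N)) ^ ((5 : ℝ) / 9) := by
  obtain ⟨C, hC, h⟩ := ZS.main_bound d θ hd
  refine ⟨C, hC, ⌈Real.exp (Real.exp 1)⌉₊, fun N hN h2 => ?_⟩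
  refine (h N (by omega)).trans ?_
  have hNR : Real.exp (Real.exp 1) ≤ N := (Nat.le_ceil _).trans (by exact_mod_cast hN)
  have hN0 : (0:ℝ) < N := lt_of_lt_of_le (Real.exp_pos _) hNR
  have hl : Real.exp 1 ≤ Real.log N := (Real.le_log_iff_exp_le hN0).2 hNR
  have hl0 : 0 < Real.log N := lt_of_lt_of_le (Real.exp_pos _) hl
  have hll : 1 ≤ Real.log (Real.log N) := (Real.le_log_iff_exp_le hl0).2 hl
  have hl1 : 1 ≤ Real.log N := (Real.one_le_exp zero_le_one).trans hl
  have a1 : 1 ≤ (Real.log N) ^ ((2 : ℝ) / 3) := Real.one_le_rpow hl1 (by norm_num)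
  have a2 : 1 ≤ (Real.log (Real.log N)) ^ ((5 : ℝ) / 9) := Real.one_le_rpow hll (by norm_num)
  rw [mul_assoc]
  exact le_mul_of_one_le_right hC.le (one_le_mul_of_one_le_of_one_le a1 a2)
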